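/- arXiv:2109.10319 — 5 statements merged into one kernel-verified Lean document; each statement's English description precedes it below -/
import Mathlib

section
/- Under the Bipartite Distribution-Free model BiDFM(Z_r, Z_c, P, ρ) with K_r ≤ K_c, let Ω = U_r Λ U_c' be the compact singular value decomposition of Ω = ρ Z_r P Z_c' (so U_r ∈ R^{n_r×K_r}, U_c ∈ R^{n_c×K_r}, U_r'U_r = I_{K_r}, U_c'U_c = I_{K_r}, Λ the diagonal matrix of the K_r nonzero singular values). Then there exists X_r ∈ R^{K_r×K_r} with U_r = Z_r X_r and ‖X_r(k,:) − X_r(l,:)‖_F = (n_{r,k}^{-1} + n_{r,l}^{-1})^{1/2} for all 1 ≤ k < l ≤ K_r, where n_{r,k} is the number of row nodes in the k-th row cluster; and there exists X_c ∈ R^{K_c×K_r} with U_c = Z_c X_c. Consequently U_r(i_r,:) = U_r(ī_r,:) whenever two row nodes i_r, ī_r lie in the same row cluster, and U_c(j_c,:) = U_c(j̄_c,:) whenever two column nodes j_c, j̄_c lie in the same column cluster. -/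
open Matrix Finset MeasureTheory ProbabilityTheory Filter Asymptotics

noncomputable section

/-- The membership matrix associated with a label function `g`:
`memMat g i k = 1` if node `i` belongs to cluster `k`, and `0` otherwise. -/
def memMat {n K : ℕ} (g : Fin n → Fin K) : Matrix (Fin n) (Fin K) ℝ :=
  fun i k => if g i = k then 1 else 0

/-- The number of nodes in cluster `k`. -/
def clusterSize {n K : ℕ} (g : Fin n → Fin K) (k : Fin K) : ℕ :=
  (Finset.univ.filter fun i => g i = k).card

/-- The minimum cluster size. -/
def minClusterSize {n K : ℕ} (g : Fin n → Fin K) : ℕ :=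
  sInf (Set.range (clusterSize g))

/-- The maximum cluster size. -/
def maxClusterSize {n K : ℕ} (g : Fin n → Fin K) : ℕ :=
  sSup (Set.range (clusterSize g))

/-- Frobenius norm of a real matrix. -/
def frobNorm {m n : ℕ} (M : Matrix (Fin m) (Fin n) ℝ) : ℝ :=
  Real.sqrt (∑ i, ∑ j, (M i j) ^ 2)

/-- Euclidean distance between rows `k` and `l` of a matrix. -/
def rowDist {K J : ℕ} (M : Matrix (Fin K) (Fin J) ℝ) (k l : Fin K) : ℝ :=
  Real.sqrt (∑ j, (M k j - M l j) ^ 2)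

/-- Euclidean norm of row `k` of a matrix. -/
def rowNormF {K J : ℕ} (M : Matrix (Fin K) (Fin J) ℝ) (k : Fin K) : ℝ :=
  Real.sqrt (∑ j, (M k j) ^ 2)

/-- Euclidean norm of column `k` of a matrix. -/
def colNormF {m K : ℕ} (M : Matrix (Fin m) (Fin K) ℝ) (k : Fin K) : ℝ :=
  Real.sqrt (∑ i, (M i k) ^ 2)

/-- Euclidean norm of a vector. -/
def vecNormF {n : ℕ} (v : Fin n → ℝ) : ℝ :=
  Real.sqrt (∑ i, (v i) ^ 2)

/-- Spectral norm (ℓ₂ operator norm) of a real matrix. -/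
def specNorm {m n : ℕ} (M : Matrix (Fin m) (Fin n) ℝ) : ℝ :=
  sSup {c | ∃ x : Fin n → ℝ, (∑ j, (x j) ^ 2) ≤ 1 ∧
    c = Real.sqrt (∑ i, (M.mulVec x i) ^ 2)}

/-- The `k`-th largest value (1-indexed) among `f 0, …, f (n-1)`. -/
def kthLargest {n : ℕ} (f : Fin n → ℝ) (k : ℕ) : ℝ :=
  ((Finset.univ.val.map f).sort (· ≤ ·)).getD (n - k) 0

/-- The `k`-th largest eigenvalue (1-indexed) of `M * Mᴴ` (`= M Mᵀ` over `ℝ`). -/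
def kthEigMulSelf {m n : ℕ} (M : Matrix (Fin m) (Fin n) ℝ) (k : ℕ) : ℝ :=
  kthLargest (Matrix.isHermitian_mul_conjTranspose_self M).eigenvalues k

/-- The `k`-th largest singular value (1-indexed) of `M`. -/
def kthSingular {m n : ℕ} (M : Matrix (Fin m) (Fin n) ℝ) (k : ℕ) : ℝ :=
  Real.sqrt (kthEigMulSelf M k)

/-- Row-normalized version of a matrix: each row is divided by its Euclidean norm. -/
def rowNormalize {m n : ℕ} (M : Matrix (Fin m) (Fin n) ℝ) : Matrix (Fin m) (Fin n) ℝ :=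
  fun i j => M i j / Real.sqrt (∑ l, (M i l) ^ 2)

/-- `U`, `L`, `V` form the rank-`K` truncated singular value decomposition of `A`
corresponding to the `K` largest singular values: `U` and `V` have orthonormal columns,
`L` is diagonal carrying the `K` largest singular values of `A`, and the columns of `U`
(resp. `V`) are corresponding left (resp. right) singular vectors. -/
def IsTruncSVD {m n K : ℕ} (A : Matrix (Fin m) (Fin n) ℝ)
    (U : Matrix (Fin m) (Fin K) ℝ) (L : Matrix (Fin K) (Fin K) ℝ)
    (V : Matrix (Fin n) (Fin K) ℝ) : Prop :=
  Uᵀ * U = 1 ∧ Vᵀ * V = 1 ∧ (∀ k l, k ≠ l → L k l = 0) ∧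
    (∀ k : Fin K, L k k = kthSingular A (k.1 + 1)) ∧
    A * V = U * L ∧ Aᵀ * U = V * L

/-- `(g, X)` is a global minimizer of the K-means objective
`‖Z X - U‖_F²` over membership matrices `Z` (equivalently label functions `g'`)
and center matrices `X'`. -/
def IsKMeansFit {n K J : ℕ} (g : Fin n → Fin K) (X : Matrix (Fin K) (Fin J) ℝ)
    (U : Matrix (Fin n) (Fin J) ℝ) : Prop :=
  ∀ (g' : Fin n → Fin K) (X' : Matrix (Fin K) (Fin J) ℝ),
    ∑ i, ∑ j, (U i j - X (g i) j) ^ 2 ≤ ∑ i, ∑ j, (U i j - X' (g' i) j) ^ 2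

/-- The clustering error of estimated labels `ghat` w.r.t. true labels `g`:
`min_{π ∈ S_K} max_k (|C_k ∩ Ĉ_{π(k)}ᶜ| + |C_kᶜ ∩ Ĉ_{π(k)}|) / n_k`. -/
def clusterErr {n K : ℕ} (g ghat : Fin n → Fin K) : ℝ :=
  ⨅ π : Equiv.Perm (Fin K), ⨆ k : Fin K,
    (((Finset.univ.filter fun i => g i = k ∧ ghat i ≠ π k).card : ℝ) +
      ((Finset.univ.filter fun i => g i ≠ k ∧ ghat i = π k).card : ℝ)) /
      (clusterSize g k : ℝ)

end

theorem aux_memMat_mul {n K J : ℕ} (g : Fin n → Fin K) (X : Matrix (Fin K) (Fin J) ℝ)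
    (i : Fin n) (j : Fin J) : (memMat g * X) i j = X (g i) j := by
  simp [Matrix.mul_apply, memMat]

theorem aux_memMat_gram {n K : ℕ} (g : Fin n → Fin K) :
    (memMat g)ᵀ * memMat g = Matrix.diagonal (fun k => (clusterSize g k : ℝ)) := by
  ext k l
  rw [Matrix.mul_apply, Matrix.diagonal_apply]
  by_cases h : k = l
  · subst h
    have h0 : ∀ i, (memMat g)ᵀ k i * memMat g i k = if g i = k then (1 : ℝ) else 0 := by
      intro i
      by_cases h1 : g i = k <;> simp [memMat, h1]
    simp only [h0]
    simp [clusterSize]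
  · rw [if_neg h]
    apply Finset.sum_eq_zero
    intro i _
    by_cases h1 : g i = k
    · have : g i ≠ l := fun h2 => h (h1.symm.trans h2)
      simp [memMat, this]
    · simp [memMat, h1]

/-- Lemma 2.1 of the paper. Under `BiDFM(Z_r, Z_c, P, ρ)` with
`K_r ≤ K_c`, if `Ω = U_r Λ U_cᵀ` is a compact SVD of `Ω = ρ Z_r P Z_cᵀ`, then
`U_r = Z_r X_r` with prescribed row distances for `X_r`, `U_c = Z_c X_c` for some `X_c`,
and nodes in the same cluster have equal rows in `U_r` (resp. `U_c`). -/
theorem stmt_0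
    {nr nc Kr Kc : ℕ} (hK : Kr ≤ Kc)
    (gr : Fin nr → Fin Kr) (gc : Fin nc → Fin Kc)
    (hgr : Function.Surjective gr) (hgc : Function.Surjective gc)
    (P : Matrix (Fin Kr) (Fin Kc) ℝ) (hPrank : P.rank = Kr)
    (hPle : ∀ k l, |P k l| ≤ 1) (hPmax : ∃ k l, |P k l| = 1)
    (ρ : ℝ) (hρ : 0 < ρ)
    (Ω : Matrix (Fin nr) (Fin nc) ℝ)
    (hΩ : Ω = ρ • (memMat gr * P * (memMat gc)ᵀ))
    (Ur : Matrix (Fin nr) (Fin Kr) ℝ) (Uc : Matrix (Fin nc) (Fin Kr) ℝ)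
    (Λ : Matrix (Fin Kr) (Fin Kr) ℝ)
    (hUr : Urᵀ * Ur = 1) (hUc : Ucᵀ * Uc = 1)
    (hΛdiag : ∀ k l, k ≠ l → Λ k l = 0) (hΛpos : ∀ k, 0 < Λ k k)
    (hSVD : Ω = Ur * Λ * Ucᵀ) :
    (∃ Xr : Matrix (Fin Kr) (Fin Kr) ℝ,
        Ur = memMat gr * Xr ∧
        ∀ k l : Fin Kr, k < l →
          rowDist Xr k l =
            Real.sqrt ((clusterSize gr k : ℝ)⁻¹ + (clusterSize gr l : ℝ)⁻¹)) ∧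
    (∃ Xc : Matrix (Fin Kc) (Fin Kr) ℝ, Uc = memMat gc * Xc) ∧
    (∀ i i' : Fin nr, gr i = gr i' → Ur i = Ur i') ∧
    (∀ j j' : Fin nc, gc j = gc j' → Uc j = Uc j') := by
  have hΛ : Λ = Matrix.diagonal (fun k => Λ k k) := by
    ext k l
    by_cases h : k = l
    · subst h; simp
    · rw [Matrix.diagonal_apply_ne _ h, hΛdiag k l h]
  obtain ⟨M, hM⟩ : ∃ M : Matrix (Fin Kr) (Fin Kr) ℝ, M = Matrix.diagonal (fun k => (Λ k k)⁻¹) :=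
    ⟨_, rfl⟩
  have hΛM : Λ * M = 1 := by
    rw [hΛ, hM, Matrix.diagonal_mul_diagonal, ← Matrix.diagonal_one]
    congr 1
    funext k
    simpa using mul_inv_cancel₀ (hΛpos k).ne'
  have hΛt : Λᵀ = Λ := by
    rw [hΛ, Matrix.diagonal_transpose]
  have h1 : Ur = memMat gr * (ρ • (P * ((memMat gc)ᵀ * (Uc * M)))) := by
    have : Ω * (Uc * M) = Ur := by
      rw [hSVD, Matrix.mul_assoc, ← Matrix.mul_assoc Ucᵀ, hUc, Matrix.one_mul,
        Matrix.mul_assoc, hΛM, Matrix.mul_one]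
    rw [← this, hΩ]
    simp only [Matrix.smul_mul, Matrix.mul_smul, Matrix.mul_assoc]
  have h2 : Uc = memMat gc * (ρ • (Pᵀ * ((memMat gr)ᵀ * (Ur * M)))) := by
    have : Ωᵀ * (Ur * M) = Uc := by
      rw [hSVD, Matrix.transpose_mul, Matrix.transpose_mul, Matrix.transpose_transpose, hΛt,
        Matrix.mul_assoc, Matrix.mul_assoc, ← Matrix.mul_assoc Urᵀ, hUr, Matrix.one_mul,
        hΛM, Matrix.mul_one]
    rw [← this, hΩ]
    simp only [Matrix.transpose_smul, Matrix.transpose_mul, Matrix.transpose_transpose,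
      Matrix.smul_mul, Matrix.mul_smul, Matrix.mul_assoc]
  generalize (ρ • (P * ((memMat gc)ᵀ * (Uc * M)))) = Xr at h1
  generalize (ρ • (Pᵀ * ((memMat gr)ᵀ * (Ur * M)))) = Xc at h2
  refine ⟨⟨Xr, h1, ?_⟩, ⟨Xc, h2⟩, ?_, ?_⟩
  · intro k l hkl
    have h3 : (Xrᵀ * Matrix.diagonal (fun k => (clusterSize gr k : ℝ))) * Xr = 1 := by
      rw [← aux_memMat_gram, ← hUr, h1, Matrix.transpose_mul]
      simp only [Matrix.mul_assoc]
    have h4 := mul_eq_one_comm.mp h3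
    rw [← Matrix.mul_assoc] at h4
    have hpos : ∀ b, (clusterSize gr b : ℝ) ≠ 0 := by
      intro b
      obtain ⟨i, hi⟩ := hgr b
      have : 0 < clusterSize gr b := Finset.card_pos.mpr ⟨i, by simp [hi]⟩
      exact_mod_cast this.ne'
    have h5 : ∀ a b, ∑ j, Xr a j * Xr b j = if a = b then (clusterSize gr b : ℝ)⁻¹ else 0 := by
      intro a b
      have h6 := congrFun (congrFun h4 a) b
      rw [Matrix.mul_diagonal, Matrix.mul_apply, Matrix.one_apply] at h6
      simp only [Matrix.transpose_apply] at h6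
      rw [eq_div_of_mul_eq (hpos b) h6]
      split_ifs <;> simp
    unfold rowDist
    congr 1
    have h7 : ∑ j, (Xr k j - Xr l j) ^ 2 = ∑ j, Xr k j * Xr k j + ∑ j, Xr l j * Xr l j
        - 2 * ∑ j, Xr k j * Xr l j := by
      rw [Finset.mul_sum, ← Finset.sum_add_distrib, ← Finset.sum_sub_distrib]
      exact Finset.sum_congr rfl fun j _ => by ring
    rw [h7, h5, h5, h5, if_pos rfl, if_pos rfl, if_neg hkl.ne]
    ring
  · intro i i' h
    funext j
    rw [h1, aux_memMat_mul, aux_memMat_mul, h]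
  · intro i i' h
    funext j
    rw [h2, aux_memMat_mul, aux_memMat_mul, h]
end

section
/- Under BiDFM(Z_r, Z_c, P, ρ) with K_r = K_c, writing Ω = U_r Λ U_c' for the compact singular value decomposition of Ω = ρ Z_r P Z_c' and U_c = Z_c X_c with X_c ∈ R^{K_c×K_r}, one has ‖X_c(k,:) − X_c(l,:)‖_F = (n_{c,k}^{-1} + n_{c,l}^{-1})^{1/2} for all 1 ≤ k < l ≤ K_c, where n_{c,k} is the number of column nodes in the k-th column cluster. -/
open Matrix Finset MeasureTheory ProbabilityTheory Filter Asymptotics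

/-- Under `BiDFM(Z_r, Z_c, P, ρ)` with `K_r = K_c = K`, writing
`Ω = U_r Λ U_cᵀ` for the compact SVD of `Ω = ρ Z_r P Z_cᵀ` and `U_c = Z_c X_c`,
one has `‖X_c(k,:) - X_c(l,:)‖_F = (n_{c,k}⁻¹ + n_{c,l}⁻¹)^{1/2}` for all `k < l`. -/
theorem stmt_1
    {nr nc K : ℕ}
    (gr : Fin nr → Fin K) (gc : Fin nc → Fin K)
    (hgr : Function.Surjective gr) (hgc : Function.Surjective gc)
    (P : Matrix (Fin K) (Fin K) ℝ) (hPrank : P.rank = K)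
    (hPle : ∀ k l, |P k l| ≤ 1) (hPmax : ∃ k l, |P k l| = 1)
    (ρ : ℝ) (hρ : 0 < ρ)
    (Ω : Matrix (Fin nr) (Fin nc) ℝ)
    (hΩ : Ω = ρ • (memMat gr * P * (memMat gc)ᵀ))
    (Ur : Matrix (Fin nr) (Fin K) ℝ) (Uc : Matrix (Fin nc) (Fin K) ℝ)
    (Λ : Matrix (Fin K) (Fin K) ℝ)
    (hUr : Urᵀ * Ur = 1) (hUc : Ucᵀ * Uc = 1)
    (hΛdiag : ∀ k l, k ≠ l → Λ k l = 0) (hΛpos : ∀ k, 0 < Λ k k)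
    (hSVD : Ω = Ur * Λ * Ucᵀ)
    (Xc : Matrix (Fin K) (Fin K) ℝ) (hXc : Uc = memMat gc * Xc) :
    ∀ k l : Fin K, k < l →
      rowDist Xc k l =
        Real.sqrt ((clusterSize gc k : ℝ)⁻¹ + (clusterSize gc l : ℝ)⁻¹) := by
  have hZ : (memMat gc)ᵀ * memMat gc = Matrix.diagonal (fun k => (clusterSize gc k : ℝ)) := by
    ext a b
    simp only [Matrix.mul_apply, Matrix.transpose_apply, memMat, Matrix.diagonal_apply, clusterSize]
    by_cases hab : a = b
    · subst hab
      rw [if_pos rfl, Finset.card_filter]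
      push_cast
      refine Finset.sum_congr rfl fun i _ => ?_
      by_cases h : gc i = a <;> simp [h]
    · rw [if_neg hab]
      apply Finset.sum_eq_zero
      intro i _
      by_cases h : gc i = a
      · have : gc i ≠ b := fun h' => hab (h.symm.trans h')
        simp [this]
      · simp [h]
  have h1 : (Xcᵀ * Matrix.diagonal (fun k => (clusterSize gc k : ℝ))) * Xc = 1 := by
    rw [← hZ, ← hUc, hXc, Matrix.transpose_mul]
    simp only [Matrix.mul_assoc]
  have h2 := mul_eq_one_comm.mp h1
  rw [← Matrix.mul_assoc] at h2
  have h3 : ∀ a b, (∑ j, Xc a j * Xc b j) * (clusterSize gc b : ℝ) = if a = b then 1 else 0 := by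
    intro a b
    have := congrFun (congrFun h2 a) b
    rw [Matrix.mul_diagonal, Matrix.one_apply, Matrix.mul_apply] at this
    simpa using this
  have hn : ∀ a, (clusterSize gc a : ℝ) ≠ 0 := by
    intro a h0
    have := h3 a a
    rw [h0] at this
    simp at this
  intro k l hkl
  unfold rowDist
  congr 1
  have e1 : ∑ j, (Xc k j - Xc l j) ^ 2 = ∑ j, Xc k j * Xc k j - 2 * ∑ j, Xc k j * Xc l j
      + ∑ j, Xc l j * Xc l j := by
    rw [Finset.mul_sum, ← Finset.sum_sub_distrib, ← Finset.sum_add_distrib]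
    exact Finset.sum_congr rfl fun j _ => by ring
  have a1 : ∑ j, Xc k j * Xc k j = (clusterSize gc k : ℝ)⁻¹ :=
    eq_inv_of_mul_eq_one_left (by simpa using h3 k k)
  have a2 : ∑ j, Xc l j * Xc l j = (clusterSize gc l : ℝ)⁻¹ :=
    eq_inv_of_mul_eq_one_left (by simpa using h3 l l)
  have a3 : ∑ j, Xc k j * Xc l j = 0 := by
    have := h3 k l
    rw [if_neg hkl.ne] at this
    exact (mul_eq_zero.mp this).resolve_right (hn l)
  rw [e1, a1, a2, a3]
  ring
end

section
/- Under BiDFM(Z_r, Z_c, P, ρ), let Ω = U_r Λ U_c' be the compact singular value decomposition of Ω = ρ Z_r P Z_c' and let Û_r ∈ R^{n_r×K_r}, Û_c ∈ R^{n_c×K_r} be the matrices of left and right singular vectors of A corresponding to its K_r largest singular values. Then there exists a K_r × K_r orthogonal matrix Ô such that max( ‖Û_r Ô − U_r‖_F , ‖Û_c Ô − U_c‖_F ) ≤ 2√(2K_r) ‖A − Ω‖ / ( σ_{K_r}(P) ρ √(n_{r,min} n_{c,min}) ). -/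
open Matrix Finset MeasureTheory ProbabilityTheory Filter Asymptotics

section Aux

lemma kth_aux {n : ℕ} (f : Fin n → ℝ) (k : ℕ) (hk : 1 ≤ k) (hkn : k ≤ n) :
    ∃ l : List ℝ, l.length = n ∧ l.Pairwise (· ≤ ·) ∧ (l : Multiset ℝ) = Finset.univ.val.map f ∧
      ∃ h : n - k < l.length, kthLargest f k = l[n - k] := by
  have hl : ((Finset.univ.val.map f).sort (· ≤ ·)).length = n := by simp
  have h : n - k < ((Finset.univ.val.map f).sort (· ≤ ·)).length := by omega
  refine ⟨_, hl, Multiset.pairwise_sort _ _, Multiset.sort_eq _ _, h, ?_⟩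
  unfold kthLargest
  rw [List.getD_eq_getElem]

lemma kth_mem {n : ℕ} (f : Fin n → ℝ) (k : ℕ) (hk : 1 ≤ k) (hkn : k ≤ n) :
    ∃ i, kthLargest f k = f i := by
  obtain ⟨l, h1, h2, h3, h, h4⟩ := kth_aux f k hk hkn
  have : kthLargest f k ∈ (l : Multiset ℝ) := by rw [h4]; exact List.getElem_mem h
  rw [h3] at this
  obtain ⟨i, -, hi⟩ := Multiset.mem_map.1 this
  exact ⟨i, hi.symm⟩

lemma kth_get {n : ℕ} (f : Fin n → ℝ) (l : List ℝ)
    (h3 : (l : Multiset ℝ) = Finset.univ.val.map f) (i : Fin n) :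
    ∃ j, ∃ h : j < l.length, l[j] = f i := by
  have : f i ∈ (l : Multiset ℝ) := by
    rw [h3]; exact Multiset.mem_map.2 ⟨i, Finset.mem_univ_val i, rfl⟩
  exact List.getElem_of_mem (Multiset.mem_coe.1 this)

lemma kth_min {n : ℕ} (f : Fin n → ℝ) (i : Fin n) : kthLargest f n ≤ f i := by
  obtain ⟨l, h1, h2, h3, h, h4⟩ := kth_aux f n (by have := i.2; omega) le_rfl
  obtain ⟨j, hj, e⟩ := kth_get f l h3 i
  rw [h4, ← e]
  rcases Nat.eq_or_lt_of_le (show n - n ≤ j by omega) with h5 | h5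
  · subst h5; exact le_rfl
  · exact List.pairwise_iff_getElem.1 h2 _ _ _ _ h5

lemma kth_max {n : ℕ} (f : Fin n → ℝ) (i : Fin n) : f i ≤ kthLargest f 1 := by
  obtain ⟨l, h1, h2, h3, h, h4⟩ := kth_aux f 1 le_rfl (by have := i.2; omega)
  obtain ⟨j, hj, e⟩ := kth_get f l h3 i
  rw [h4, ← e]
  rcases Nat.eq_or_lt_of_le (show j ≤ n - 1 by omega) with h5 | h5
  · subst h5; exact le_rfl
  · exact List.pairwise_iff_getElem.1 h2 _ _ _ _ h5

lemma kth_count {n : ℕ} (f : Fin n → ℝ) (k : ℕ) (hk : 1 ≤ k) (hkn : k ≤ n) (c : ℝ)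
    (hc : kthLargest f k < c) : n + 1 ≤ k + (Finset.univ.filter fun i => f i < c).card := by
  obtain ⟨l, h1, h2, h3, h, h4⟩ := kth_aux f k hk hkn
  have e1 : (Finset.univ.filter fun i => f i < c).card = l.countP (fun x => decide (x < c)) := by
    have : Multiset.countP (fun x => x < c) (l : Multiset ℝ)
      = (Finset.univ.filter fun i => f i < c).card := by
      rw [h3, Multiset.countP_map]; rfl
    rw [← this, Multiset.coe_countP]
  have e2 : (l.take (n - k + 1)).countP (fun x => decide (x < c)) = n - k + 1 := by
    have hlen : (l.take (n - k + 1)).length = n - k + 1 := by simp; omega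
    rw [List.countP_eq_length.2, hlen]
    intro a ha
    obtain ⟨j, hj, rfl⟩ := List.getElem_of_mem ha
    rw [List.getElem_take]
    simp only [decide_eq_true_eq]
    refine lt_of_le_of_lt ?_ (h4 ▸ hc)
    rcases Nat.eq_or_lt_of_le (show j ≤ n - k by omega) with h5 | h5
    · subst h5; exact le_rfl
    · exact List.pairwise_iff_getElem.1 h2 _ _ _ _ h5
  have e3 := (List.take_sublist (n - k + 1) l).countP_le (p := fun x => decide (x < c))
  omega

lemma spectral' {n : ℕ} (M : Matrix (Fin n) (Fin n) ℝ) (hM : M.IsHermitian) :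
    ∃ V : Matrix (Fin n) (Fin n) ℝ, Vᵀ * V = 1 ∧ V * Vᵀ = 1 ∧
      M = V * diagonal hM.eigenvalues * Vᵀ := by
  refine ⟨hM.eigenvectorUnitary, ?_, ?_, ?_⟩
  · exact Unitary.coe_star_mul_self hM.eigenvectorUnitary
  · exact Unitary.coe_mul_star_self hM.eigenvectorUnitary
  · exact hM.spectral_theorem

lemma dp_mulVec {m n : ℕ} (M : Matrix (Fin m) (Fin n) ℝ) (x : Fin m → ℝ) (y : Fin n → ℝ) :
    x ⬝ᵥ (M *ᵥ y) = (Mᵀ *ᵥ x) ⬝ᵥ y := by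
  rw [dotProduct_mulVec, mulVec_transpose]

lemma dp_mulVec2 {m n p : ℕ} (M : Matrix (Fin m) (Fin n) ℝ) (N : Matrix (Fin m) (Fin p) ℝ)
    (x : Fin n → ℝ) (y : Fin p → ℝ) :
    (M *ᵥ x) ⬝ᵥ (N *ᵥ y) = x ⬝ᵥ ((Mᵀ * N) *ᵥ y) := by
  rw [← mulVec_mulVec, dp_mulVec Mᵀ, transpose_transpose]

lemma dp_nonneg {n : ℕ} (x : Fin n → ℝ) : 0 ≤ x ⬝ᵥ x := by
  simpa using dotProduct_star_self_nonneg x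

lemma dp_pos {n : ℕ} (x : Fin n → ℝ) (h : x ≠ 0) : 0 < x ⬝ᵥ x :=
  lt_of_le_of_ne (dp_nonneg x) (fun h' => h (dotProduct_self_eq_zero.1 h'.symm))

lemma dp_cs {n : ℕ} (x y : Fin n → ℝ) : (x ⬝ᵥ y) ^ 2 ≤ (x ⬝ᵥ x) * (y ⬝ᵥ y) := by
  have := Finset.sum_mul_sq_le_sq_mul_sq Finset.univ x y
  simpa [dotProduct, sq] using this

/-- quadratic form through an orthogonal diagonalization -/
lemma quad_diag {n : ℕ} (V : Matrix (Fin n) (Fin n) ℝ) (d : Fin n → ℝ) (x : Fin n → ℝ) :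
    x ⬝ᵥ ((V * diagonal d * Vᵀ) *ᵥ x) = ∑ i, d i * ((Vᵀ *ᵥ x) i) ^ 2 := by
  rw [← mulVec_mulVec, ← mulVec_mulVec, dp_mulVec]
  simp only [dotProduct, mulVec_diagonal]
  refine Finset.sum_congr rfl fun i _ => by ring

lemma orth_dp {n : ℕ} (V : Matrix (Fin n) (Fin n) ℝ) (h : V * Vᵀ = 1) (x : Fin n → ℝ) :
    ∑ i, ((Vᵀ *ᵥ x) i) ^ 2 = x ⬝ᵥ x := by
  have : (Vᵀ *ᵥ x) ⬝ᵥ (Vᵀ *ᵥ x) = x ⬝ᵥ x := by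
    rw [dp_mulVec2, transpose_transpose, h, one_mulVec]
  rw [← this]; simp [dotProduct, sq]

lemma specNorm_bdd {m n : ℕ} (M : Matrix (Fin m) (Fin n) ℝ) :
    BddAbove {c | ∃ x : Fin n → ℝ, (∑ j, (x j) ^ 2) ≤ 1 ∧
    c = Real.sqrt (∑ i, (M.mulVec x i) ^ 2)} := by
  refine ⟨Real.sqrt (∑ i, ∑ j, (M i j) ^ 2), ?_⟩
  rintro c ⟨x, hx, rfl⟩
  apply Real.sqrt_le_sqrt
  refine Finset.sum_le_sum fun i _ => ?_
  have := Finset.sum_mul_sq_le_sq_mul_sq Finset.univ (M i) x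
  refine this.trans ?_
  have h0 : 0 ≤ ∑ j, (M i j) ^ 2 := Finset.sum_nonneg fun j _ => sq_nonneg _
  nlinarith

lemma specNorm_nonneg {m n : ℕ} (M : Matrix (Fin m) (Fin n) ℝ) : 0 ≤ specNorm M := by
  refine le_csSup (specNorm_bdd M) ⟨0, by simp, by simp⟩

lemma specNorm_le {m n : ℕ} (M : Matrix (Fin m) (Fin n) ℝ) (x : Fin n → ℝ) :
    (M *ᵥ x) ⬝ᵥ (M *ᵥ x) ≤ specNorm M ^ 2 * (x ⬝ᵥ x) := by
  by_cases hx : x = 0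
  · subst hx; simp
  have hp := dp_pos x hx
  set r := Real.sqrt (x ⬝ᵥ x) with hr
  have hr2 : r ^ 2 = x ⬝ᵥ x := Real.sq_sqrt hp.le
  have hrp : 0 < r := Real.sqrt_pos.2 hp
  have h := le_csSup (specNorm_bdd M) ⟨r⁻¹ • x, by
    have : ∑ j, ((r⁻¹ • x) j) ^ 2 = (r⁻¹) ^ 2 * (x ⬝ᵥ x) := by
      simp only [dotProduct, Pi.smul_apply, smul_eq_mul, Finset.mul_sum]
      exact Finset.sum_congr rfl fun i _ => by ring
    rw [this, ← hr2]; field_simp; exact le_rfl, rfl⟩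
  change _ ≤ specNorm M at h
  have e : ∑ i, ((M *ᵥ (r⁻¹ • x)) i) ^ 2 = (r⁻¹) ^ 2 * ((M *ᵥ x) ⬝ᵥ (M *ᵥ x)) := by
    simp only [mulVec_smul, dotProduct, Pi.smul_apply, smul_eq_mul, Finset.mul_sum]
    exact Finset.sum_congr rfl fun i _ => by ring
  rw [e] at h
  have h2 := (Real.sqrt_le_left (specNorm_nonneg M)).1 h
  rw [inv_pow, inv_mul_le_iff₀ (by positivity)] at h2
  rw [← hr2]; linarith

/-- abstract operator bound transfers to the transpose -/
lemma op_bilin {m n : ℕ} (M : Matrix (Fin m) (Fin n) ℝ) (e : ℝ)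
    (h : ∀ x, (M *ᵥ x) ⬝ᵥ (M *ᵥ x) ≤ e ^ 2 * (x ⬝ᵥ x)) (x : Fin m → ℝ) :
    (Mᵀ *ᵥ x) ⬝ᵥ (Mᵀ *ᵥ x) ≤ e ^ 2 * (x ⬝ᵥ x) := by
  set y := Mᵀ *ᵥ x with hy
  have h1 : y ⬝ᵥ y = x ⬝ᵥ (M *ᵥ y) := (dp_mulVec M x y).symm
  have h2 := dp_cs x (M *ᵥ y)
  rw [← h1] at h2
  have h3 := h y
  by_contra hc
  push Not at hc
  have hx := dp_nonneg x
  have hyp : 0 < y ⬝ᵥ y := lt_of_le_of_lt (by positivity) hc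
  nlinarith [mul_le_mul_of_nonneg_left h3 hx]

lemma svd' {n : ℕ} (M : Matrix (Fin n) (Fin n) ℝ) :
    ∃ (X Y : Matrix (Fin n) (Fin n) ℝ) (s : Fin n → ℝ), Xᵀ * X = 1 ∧ X * Xᵀ = 1 ∧
      Yᵀ * Y = 1 ∧ Y * Yᵀ = 1 ∧ (∀ i, 0 ≤ s i) ∧ M = X * diagonal s * Yᵀ := by
  obtain ⟨Y, hY1, hY2, hS⟩ := spectral' (Mᵀ * M) (isHermitian_conjTranspose_mul_self M)
  set d := (isHermitian_conjTranspose_mul_self M).eigenvalues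
  have hD : Yᵀ * (Mᵀ * M) * Y = diagonal d := by
    rw [hS]
    calc _ = (Yᵀ * Y) * diagonal d * (Yᵀ * Y) := by simp only [Matrix.mul_assoc]; rfl
      _ = _ := by rw [hY1]; simp
  have hG : (M * Y)ᵀ * (M * Y) = diagonal d := by
    rw [← hD]; simp only [transpose_mul, Matrix.mul_assoc]
  let w : Fin n → EuclideanSpace ℝ (Fin n) := fun i => WithLp.toLp 2 ((M * Y)ᵀ i)
  have hw : ∀ i j, inner ℝ (w i) (w j) = if i = j then d i else 0 := by
    intro i j
    have := congrFun (congrFun hG i) j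
    rw [diagonal_apply] at this
    rw [← this, Matrix.mul_apply]
    simp only [w, PiLp.inner_apply, RCLike.inner_apply, conj_trivial, transpose_apply]
    exact Finset.sum_congr rfl fun k _ => mul_comm _ _
  let v : Fin n → EuclideanSpace ℝ (Fin n) := fun i => (‖w i‖)⁻¹ • w i
  let S : Set (Fin n) := {i | w i ≠ 0}
  have hv : Orthonormal ℝ (S.domRestrict v) := by
    constructor
    · rintro ⟨i, hi⟩
      have hi' : ‖w i‖ ≠ 0 := norm_ne_zero_iff.2 hi
      simp [v, norm_smul, hi']
    · rintro ⟨i, hi⟩ ⟨j, hj⟩ hij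
      have : i ≠ j := fun h => hij (Subtype.ext h)
      simp [v, inner_smul_left, inner_smul_right, hw, this]
  obtain ⟨b, hb⟩ := hv.exists_orthonormalBasis_extension_of_card_eq (by simp)
  let X : Matrix (Fin n) (Fin n) ℝ := Matrix.of fun i j => b j i
  have hX : Xᵀ * X = 1 := by
    ext i j
    have := b.inner_eq_ite i j
    rw [Matrix.mul_apply, Matrix.one_apply, ← this]
    simp only [X, PiLp.inner_apply, RCLike.inner_apply, conj_trivial, transpose_apply, Matrix.of_apply]
    exact Finset.sum_congr rfl fun k _ => mul_comm _ _
  refine ⟨X, Y, fun i => ‖w i‖, hX, mul_eq_one_comm.1 hX, hY1, hY2, fun i => norm_nonneg _, ?_⟩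
  have hMY : M * Y = X * diagonal fun i => ‖w i‖ := by
    ext i j
    rw [mul_diagonal]
    have e : (M * Y) i j = w j i := rfl
    rw [e]
    change w j i = b j i * ‖w j‖
    by_cases h : w j = 0
    · simp [h]
    · have h' : ‖w j‖ ≠ 0 := norm_ne_zero_iff.2 h
      rw [hb j h]
      simp [v]
      field_simp
  rw [← hMY, Matrix.mul_assoc, hY2, Matrix.mul_one]

end Aux

section Core

lemma frob_sq {m K : ℕ} (a U : Matrix (Fin m) (Fin K) ℝ) (O : Matrix (Fin K) (Fin K) ℝ)
    (ha : aᵀ * a = 1) (hU : Uᵀ * U = 1) (hO : Oᵀ * O = 1) :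
    frobNorm (a * O - U) = Real.sqrt (2 * K - 2 * trace (Oᵀ * (aᵀ * U))) := by
  unfold frobNorm
  congr 1
  have h1 : ∑ i, ∑ j, ((a * O - U) i j) ^ 2 = trace ((a * O - U)ᵀ * (a * O - U)) := by
    rw [Finset.sum_comm]
    simp only [trace, Matrix.diag, Matrix.mul_apply, transpose_apply, sq]
  have h2 : (a * O - U)ᵀ * (a * O - U) =
      Oᵀ * (aᵀ * a) * O - Oᵀ * (aᵀ * U) - (Oᵀ * (aᵀ * U))ᵀ + Uᵀ * U := by
    simp only [transpose_sub, transpose_mul, transpose_transpose, Matrix.sub_mul, Matrix.mul_sub,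
      Matrix.mul_assoc]
    abel
  rw [h1, h2, ha, hU, Matrix.mul_one, hO]
  simp only [trace_add, trace_sub, trace_transpose, trace_one, Fintype.card_fin]
  ring

lemma vec_key {n : ℕ} (p q y : Fin n → ℝ) (h γ : ℝ) (hγ : 0 < γ) (hh : 0 ≤ h)
    (hpq : p + q = (2 * h) • y) (hy : y ⬝ᵥ y = 1) (hp : γ ≤ p ⬝ᵥ p) (hq : γ ≤ q ⬝ᵥ q)
    (hp1 : p ⬝ᵥ p ≤ 1) (hq1 : q ⬝ᵥ q ≤ 1)
    (hb : 2 - p ⬝ᵥ p - q ⬝ᵥ q + 2 * ((p - q) ⬝ᵥ (p - q)) ≤ 2 * (1 - γ)) : γ ≤ p ⬝ᵥ y := by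
  have e1 : p ⬝ᵥ p + p ⬝ᵥ q = 2 * h * (p ⬝ᵥ y) := by
    rw [← dotProduct_add, hpq, dotProduct_smul, smul_eq_mul]
  have e2 : p ⬝ᵥ p + q ⬝ᵥ q + 2 * (p ⬝ᵥ q) = 4 * h ^ 2 := by
    have : (p + q) ⬝ᵥ (p + q) = 4 * h ^ 2 := by
      rw [hpq, dotProduct_smul, smul_dotProduct, hy]; simp; ring
    rw [← this]; simp only [dotProduct_add, add_dotProduct, dotProduct_comm q p]; ring
  have e3 : (p - q) ⬝ᵥ (p - q) = p ⬝ᵥ p + q ⬝ᵥ q - 2 * (p ⬝ᵥ q) := by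
    simp only [dotProduct_sub, sub_dotProduct, dotProduct_comm q p]; ring
  have e4 := dp_nonneg (p - q)
  rw [e3] at hb e4
  generalize p ⬝ᵥ p = P at *
  generalize q ⬝ᵥ q = Q at *
  generalize p ⬝ᵥ q = R at *
  generalize p ⬝ᵥ y = a at *
  have hR : 2 * h ^ 2 / 3 + γ / 3 ≤ R := by linarith
  have hh2 : γ ≤ h ^ 2 := by linarith
  have hpos : 0 < h := by
    rcases hh.lt_or_eq with h' | h'
    · exact h'
    · subst h'; norm_num at hh2; linarith
  have hh1 : h ≤ 1 := by
    have : h ^ 2 ≤ 1 := by linarith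
    nlinarith
  have hγ1 : γ ≤ 1 := by linarith
  have k : 0 ≤ γ * ((1 - h) * (2 - h)) + (1 - γ) * h ^ 2 := by
    have : 0 ≤ (1 - h) * (2 - h) := mul_nonneg (by linarith) (by linarith)
    have : 0 ≤ (1 - γ) * h ^ 2 := mul_nonneg (by linarith) (sq_nonneg _)
    positivity
  have : 2 * h * γ ≤ 2 * h * a := by nlinarith
  exact le_of_mul_le_mul_left this (by linarith)

lemma core_polar {K : ℕ} (M1 M2 : Matrix (Fin K) (Fin K) ℝ) (γ : ℝ) (hγ : 0 < γ)
    (h1 : ∀ f, γ * (f ⬝ᵥ f) ≤ (M1ᵀ *ᵥ f) ⬝ᵥ (M1ᵀ *ᵥ f))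
    (h2 : ∀ f, γ * (f ⬝ᵥ f) ≤ (M2ᵀ *ᵥ f) ⬝ᵥ (M2ᵀ *ᵥ f))
    (c1 : ∀ f, (M1ᵀ *ᵥ f) ⬝ᵥ (M1ᵀ *ᵥ f) ≤ f ⬝ᵥ f)
    (c2 : ∀ f, (M2ᵀ *ᵥ f) ⬝ᵥ (M2ᵀ *ᵥ f) ≤ f ⬝ᵥ f)
    (hb : ∀ f, 2 * (f ⬝ᵥ f) - (M1ᵀ *ᵥ f) ⬝ᵥ (M1ᵀ *ᵥ f) - (M2ᵀ *ᵥ f) ⬝ᵥ (M2ᵀ *ᵥ f)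
      + 2 * (((M1 - M2)ᵀ *ᵥ f) ⬝ᵥ ((M1 - M2)ᵀ *ᵥ f)) ≤ 2 * (1 - γ) * (f ⬝ᵥ f)) :
    ∃ O : Matrix (Fin K) (Fin K) ℝ, Oᵀ * O = 1 ∧ O * Oᵀ = 1 ∧
      K * γ ≤ trace (Oᵀ * M1) ∧ K * γ ≤ trace (Oᵀ * M2) := by
  obtain ⟨X, Y, s, hX1, hX2, hY1, hY2, hs, hS⟩ := svd' (M1 + M2)
  have tr : ∀ M : Matrix (Fin K) (Fin K) ℝ, trace ((X * Yᵀ)ᵀ * M) =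
      ∑ i, (Mᵀ *ᵥ (X *ᵥ Pi.single i 1)) ⬝ᵥ (Y *ᵥ Pi.single i 1) := by
    intro M
    have : trace ((X * Yᵀ)ᵀ * M) = trace (Xᵀ * M * Y) := by
      rw [transpose_mul, transpose_transpose, Matrix.mul_assoc, trace_mul_comm]
    rw [this]
    refine Finset.sum_congr rfl fun i _ => ?_
    rw [← dp_mulVec, ← dotProduct_comm, ← dotProduct_comm, dp_mulVec2, mulVec_mulVec]
    simp [Matrix.mul_assoc]
  have hx : ∀ i, (X *ᵥ Pi.single i (1:ℝ)) ⬝ᵥ (X *ᵥ Pi.single i 1) = 1 := by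
    intro i; rw [dp_mulVec2, hX1]; simp
  have hy : ∀ i, (Y *ᵥ Pi.single i (1:ℝ)) ⬝ᵥ (Y *ᵥ Pi.single i 1) = 1 := by
    intro i; rw [dp_mulVec2, hY1]; simp
  have hSx : ∀ i, M1ᵀ *ᵥ (X *ᵥ Pi.single i 1) + M2ᵀ *ᵥ (X *ᵥ Pi.single i 1) =
      (2 * (s i / 2)) • (Y *ᵥ Pi.single i 1) := by
    intro i
    rw [← add_mulVec, ← transpose_add, hS, mulVec_mulVec]
    have : (X * diagonal s * Yᵀ)ᵀ * X = Y * diagonal s := by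
      simp only [transpose_mul, transpose_transpose, diagonal_transpose, Matrix.mul_assoc, hX1,
        Matrix.mul_one]
    rw [this, ← mulVec_mulVec]
    have : diagonal s *ᵥ Pi.single i 1 = s i • Pi.single i (1:ℝ) := by
      ext j; rw [mulVec_diagonal]; by_cases h : j = i
      · subst h; simp
      · simp [h]
    rw [this, mulVec_smul]; congr 1; ring
  refine ⟨X * Yᵀ, ?_, ?_, ?_, ?_⟩
  · rw [transpose_mul, transpose_transpose, Matrix.mul_assoc, ← Matrix.mul_assoc Xᵀ, hX1,
      Matrix.one_mul, hY2]
  · rw [transpose_mul, transpose_transpose, Matrix.mul_assoc, ← Matrix.mul_assoc Yᵀ, hY1,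
      Matrix.one_mul, hX2]
  · rw [tr]
    have : (K : ℝ) * γ = ∑ i : Fin K, γ := by simp
    rw [this]
    refine Finset.sum_le_sum fun i _ => ?_
    have a1 := h1 (X *ᵥ Pi.single i 1)
    have a2 := h2 (X *ᵥ Pi.single i 1)
    have a3 := c1 (X *ᵥ Pi.single i 1)
    have a4 := c2 (X *ᵥ Pi.single i 1)
    have a5 := hb (X *ᵥ Pi.single i 1)
    rw [hx, mul_one] at a1 a2 a5
    rw [hx] at a3 a4
    rw [mul_one, transpose_sub, sub_mulVec] at a5
    exact vec_key _ _ _ _ γ hγ (by have := hs i; linarith) (hSx i) (hy i) a1 a2 a3 a4 a5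
  · rw [tr]
    have : (K : ℝ) * γ = ∑ i : Fin K, γ := by simp
    rw [this]
    refine Finset.sum_le_sum fun i _ => ?_
    have a1 := h1 (X *ᵥ Pi.single i 1)
    have a2 := h2 (X *ᵥ Pi.single i 1)
    have a3 := c1 (X *ᵥ Pi.single i 1)
    have a4 := c2 (X *ᵥ Pi.single i 1)
    have a5 := hb (X *ᵥ Pi.single i 1)
    rw [hx, mul_one] at a1 a2 a5
    rw [hx] at a3 a4
    rw [mul_one, transpose_sub, sub_mulVec] at a5
    refine vec_key _ _ _ _ γ hγ (by have := hs i; linarith) ((add_comm _ _).trans (hSx i))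
      (hy i) a2 a1 a4 a3 ?_
    rw [← neg_sub (M1ᵀ *ᵥ _), neg_dotProduct_neg]
    linarith

lemma zero_trace {K : ℕ} (hK : 2 ≤ K) (D : Matrix (Fin K) (Fin K) ℝ) :
    ∃ O : Matrix (Fin K) (Fin K) ℝ, Oᵀ * O = 1 ∧ O * Oᵀ = 1 ∧ trace (Oᵀ * D) = 0 := by
  obtain ⟨X, Y, s, hX1, hX2, hY1, hY2, hs, hS⟩ := svd' D
  obtain ⟨m, rfl⟩ : ∃ m, K = m + 2 := ⟨K - 2, by omega⟩
  let σ : Equiv.Perm (Fin (m + 2)) := finRotate (m + 2)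
  have hσ : ∀ i, σ i ≠ i := by
    intro i h
    have h' : i + 1 = i := by rw [← finRotate_apply]; exact h
    simp at h'
  let R : Matrix (Fin (m + 2)) (Fin (m + 2)) ℝ := Matrix.of fun i j => if σ j = i then 1 else 0
  have hR : Rᵀ * R = 1 := by
    ext i j
    simp [Matrix.mul_apply, R, Matrix.one_apply, eq_comm]
  have hR2 : R * Rᵀ = 1 := mul_eq_one_comm.1 hR
  have hO : (X * R * Yᵀ)ᵀ * (X * R * Yᵀ) = 1 := by
    calc _ = Y * (Rᵀ * (Xᵀ * X) * R) * Yᵀ := by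
          simp only [transpose_mul, transpose_transpose, Matrix.mul_assoc]
      _ = 1 := by rw [hX1, Matrix.mul_one, hR, Matrix.mul_one, hY2]
  refine ⟨X * R * Yᵀ, hO, mul_eq_one_comm.1 hO, ?_⟩
  have : (X * R * Yᵀ)ᵀ * D = Y * (Rᵀ * diagonal s * Yᵀ) := by
    rw [hS]
    calc _ = Y * (Rᵀ * (Xᵀ * X) * diagonal s * Yᵀ) := by
          simp only [transpose_mul, transpose_transpose, Matrix.mul_assoc]
      _ = _ := by rw [hX1, Matrix.mul_one]
  rw [this, trace_mul_comm, Matrix.mul_assoc, hY1, Matrix.mul_one]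
  simp only [trace, Matrix.diag, mul_diagonal, transpose_apply, R, Matrix.of_apply]
  refine Finset.sum_eq_zero fun i _ => ?_
  rw [if_neg (hσ i), zero_mul]

lemma two_trace {K : ℕ} (hK : 2 ≤ K) (M1 M2 : Matrix (Fin K) (Fin K) ℝ) :
    ∃ O : Matrix (Fin K) (Fin K) ℝ, Oᵀ * O = 1 ∧ O * Oᵀ = 1 ∧ 0 ≤ trace (Oᵀ * M1) ∧
      0 ≤ trace (Oᵀ * M2) := by
  obtain ⟨O, h1, h2, h3⟩ := zero_trace hK (M1 - M2)
  rw [Matrix.mul_sub, trace_sub] at h3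
  rcases le_total 0 (trace (Oᵀ * M1)) with h | h
  · exact ⟨O, h1, h2, h, by linarith⟩
  · refine ⟨-O, by simpa using h1, by simpa using h2, ?_, ?_⟩ <;>
    simp only [transpose_neg, Matrix.neg_mul, trace_neg] <;> linarith

/-- bound of a symmetric form through eigenvectors -/
lemma quad_le {n : ℕ} (Q : Matrix (Fin n) (Fin n) ℝ) (hQ : Q.IsHermitian) (c : ℝ)
    (h : ∀ (l : ℝ) (f : Fin n → ℝ), f ⬝ᵥ f = 1 → Q *ᵥ f = l • f → l ≤ c) (f : Fin n → ℝ) :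
    f ⬝ᵥ (Q *ᵥ f) ≤ c * (f ⬝ᵥ f) := by
  obtain ⟨V, h1, h2, h3⟩ := spectral' Q hQ
  have hd : ∀ i, hQ.eigenvalues i ≤ c := by
    intro i
    refine h _ (V *ᵥ Pi.single i 1) ?_ ?_
    · rw [dp_mulVec2, h1]; simp
    · conv_lhs => rw [h3]
      rw [mulVec_mulVec, Matrix.mul_assoc, h1, Matrix.mul_one, ← mulVec_mulVec, ← mulVec_smul]
      congr 1
      ext j; rw [mulVec_diagonal]; by_cases h : j = i
      · subst h; simp
      · simp [h]
  conv_lhs => rw [h3]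
  rw [quad_diag, ← orth_dp V h2, Finset.mul_sum]
  exact Finset.sum_le_sum fun i _ => mul_le_mul_of_nonneg_right (hd i) (sq_nonneg _)

end Core

section Core2

lemma core_b_scal (r1 r2 e1 e2 A1 A2 y X w l δ ε : ℝ) (hδ : 0 < δ)
    (id1 : l * w = r1 + r2 - 2 * y) (cs1 : r1 ^ 2 ≤ (A1 + 4 * X) * e1)
    (cs2 : r2 ^ 2 ≤ (A2 + 4 * X) * e2) (n1 : e1 ≤ ε ^ 2) (n2 : e2 ≤ ε ^ 2)
    (hq : l = A1 + A2 + 2 * X) (hLf : δ / 2 ≤ w) (hΛx : δ * X ≤ y)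
    (p1 : 0 ≤ A1) (p2 : 0 ≤ A2) (p3 : 0 ≤ X) : l ≤ 8 * ε ^ 2 / δ ^ 2 := by
  have hl0 : 0 ≤ l := by linarith
  by_contra hcon
  push Not at hcon
  have hlp : 0 < l := lt_of_le_of_lt (by positivity) hcon
  rw [div_lt_iff₀ (by positivity)] at hcon
  have c1 : r1 ^ 2 ≤ (A1 + 4 * X) * ε ^ 2 :=
    cs1.trans (mul_le_mul_of_nonneg_left n1 (by linarith))
  have c2 : r2 ^ 2 ≤ (A2 + 4 * X) * ε ^ 2 :=
    cs2.trans (mul_le_mul_of_nonneg_left n2 (by linarith))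
  have c3 : (r1 + r2) ^ 2 ≤ 2 * (l + 6 * X) * ε ^ 2 := by
    rw [hq]; nlinarith [sq_nonneg (r1 - r2)]
  have c4 : δ * (l / 2 + 2 * X) ≤ r1 + r2 := by nlinarith
  have c5 : (δ * (l / 2 + 2 * X)) ^ 2 ≤ (r1 + r2) ^ 2 :=
    pow_le_pow_left₀ (by positivity) c4 2
  have c6 : δ ^ 2 * (l / 4 * (l + 6 * X)) ≤ (δ * (l / 2 + 2 * X)) ^ 2 := by
    rw [mul_pow]
    refine mul_le_mul_of_nonneg_left ?_ (sq_nonneg _)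
    nlinarith [mul_nonneg hl0 p3, sq_nonneg X]
  have c7 : (l + 6 * X) * (8 * ε ^ 2) < (l + 6 * X) * (l * δ ^ 2) :=
    mul_lt_mul_of_pos_left hcon (by linarith)
  nlinarith


set_option maxHeartbeats 1000000 in
lemma core_b {m n K : ℕ} (U a : Matrix (Fin m) (Fin K) ℝ) (V b : Matrix (Fin n) (Fin K) ℝ)
    (Λ L M1 M2 : Matrix (Fin K) (Fin K) ℝ) (E : Matrix (Fin m) (Fin n) ℝ) (δ ε : ℝ)
    (hδ : 0 < δ)
    (hU : Uᵀ * U = 1) (hV : Vᵀ * V = 1) (ha : aᵀ * a = 1) (hb : bᵀ * b = 1)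
    (hM1 : M1 = aᵀ * U) (hM2 : M2 = bᵀ * V)
    (hE1 : E * b = a * L - U * Λ * M2ᵀ) (hE2 : Eᵀ * a = b * L - V * Λ * M1ᵀ)
    (hΛ : ∀ x, δ * (x ⬝ᵥ x) ≤ x ⬝ᵥ (Λ *ᵥ x)) (hL : ∀ x, δ / 2 * (x ⬝ᵥ x) ≤ x ⬝ᵥ (L *ᵥ x))
    (hE : ∀ x, (E *ᵥ x) ⬝ᵥ (E *ᵥ x) ≤ ε ^ 2 * (x ⬝ᵥ x)) (f : Fin K → ℝ) :
    2 * (f ⬝ᵥ f) - (M1ᵀ *ᵥ f) ⬝ᵥ (M1ᵀ *ᵥ f) - (M2ᵀ *ᵥ f) ⬝ᵥ (M2ᵀ *ᵥ f)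
      + 2 * (((M1 - M2)ᵀ *ᵥ f) ⬝ᵥ ((M1 - M2)ᵀ *ᵥ f)) ≤ 8 * ε ^ 2 / δ ^ 2 * (f ⬝ᵥ f) := by
  have hEt := op_bilin E ε hE
  set D := M1 - M2 with hD
  have hUa : Uᵀ * a = M1ᵀ := by rw [hM1, transpose_mul, transpose_transpose]
  have hVb : Vᵀ * b = M2ᵀ := by rw [hM2, transpose_mul, transpose_transpose]
  set N1 := a - U * M1ᵀ with hN1
  set N2 := b - V * M2ᵀ with hN2
  have hN1U : N1ᵀ * U = 0 := by
    rw [hN1, transpose_sub, transpose_mul, transpose_transpose, Matrix.sub_mul, Matrix.mul_assoc,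
      hU, ← hM1, Matrix.mul_one, sub_self]
  have hN2V : N2ᵀ * V = 0 := by
    rw [hN2, transpose_sub, transpose_mul, transpose_transpose, Matrix.sub_mul, Matrix.mul_assoc,
      hV, ← hM2, Matrix.mul_one, sub_self]
  have hN1a : N1ᵀ * a = 1 - M1 * M1ᵀ := by
    rw [hN1, transpose_sub, transpose_mul, transpose_transpose, Matrix.sub_mul, Matrix.mul_assoc,
      hUa, ha]
  have hN2b : N2ᵀ * b = 1 - M2 * M2ᵀ := by
    rw [hN2, transpose_sub, transpose_mul, transpose_transpose, Matrix.sub_mul, Matrix.mul_assoc,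
      hVb, hb]
  have hNN1 : N1ᵀ * N1 = 1 - M1 * M1ᵀ := by
    conv_lhs => rw [hN1]
    rw [← hN1, Matrix.mul_sub, hN1a, ← Matrix.mul_assoc, hN1U]; simp
  have hNN2 : N2ᵀ * N2 = 1 - M2 * M2ᵀ := by
    conv_lhs => rw [hN2]
    rw [← hN2, Matrix.mul_sub, hN2b, ← Matrix.mul_assoc, hN2V]; simp
  have k1 : N1ᵀ * (E * b) = (1 - M1 * M1ᵀ) * L := by
    rw [hE1, Matrix.mul_sub, ← Matrix.mul_assoc, hN1a, ← Matrix.mul_assoc, ← Matrix.mul_assoc,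
      hN1U]; simp
  have k2 : N2ᵀ * (Eᵀ * a) = (1 - M2 * M2ᵀ) * L := by
    rw [hE2, Matrix.mul_sub, ← Matrix.mul_assoc, hN2b, ← Matrix.mul_assoc, ← Matrix.mul_assoc,
      hN2V]; simp
  have k3 : Uᵀ * (E * b) = M1ᵀ * L - Λ * M2ᵀ := by
    rw [hE1, Matrix.mul_sub, ← Matrix.mul_assoc, hUa, ← Matrix.mul_assoc, ← Matrix.mul_assoc,
      hU, Matrix.one_mul]
  have k4 : Vᵀ * (Eᵀ * a) = M2ᵀ * L - Λ * M1ᵀ := by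
    rw [hE2, Matrix.mul_sub, ← Matrix.mul_assoc, hVb, ← Matrix.mul_assoc, ← Matrix.mul_assoc,
      hV, Matrix.one_mul]
  set Q : Matrix (Fin K) (Fin K) ℝ := (1 - M1 * M1ᵀ) + (1 - M2 * M2ᵀ) + (2:ℝ) • (D * Dᵀ) with hQ
  have hQt : Qᵀ = Q := by
    simp [hQ, transpose_add, transpose_sub, transpose_mul, transpose_smul]
  have hquad : ∀ f, f ⬝ᵥ (Q *ᵥ f) = (N1 *ᵥ f) ⬝ᵥ (N1 *ᵥ f) + (N2 *ᵥ f) ⬝ᵥ (N2 *ᵥ f)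
      + 2 * ((Dᵀ *ᵥ f) ⬝ᵥ (Dᵀ *ᵥ f)) := by
    intro f
    rw [dp_mulVec2, dp_mulVec2, dp_mulVec2, hNN1, hNN2, hQ, transpose_transpose, add_mulVec,
      add_mulVec, dotProduct_add, dotProduct_add, smul_mulVec, dotProduct_smul, smul_eq_mul]
  have hquad2 : f ⬝ᵥ (Q *ᵥ f) = 2 * (f ⬝ᵥ f) - (M1ᵀ *ᵥ f) ⬝ᵥ (M1ᵀ *ᵥ f)
      - (M2ᵀ *ᵥ f) ⬝ᵥ (M2ᵀ *ᵥ f) + 2 * ((Dᵀ *ᵥ f) ⬝ᵥ (Dᵀ *ᵥ f)) := by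
    rw [hquad, dp_mulVec2, dp_mulVec2, dp_mulVec2 M1ᵀ, dp_mulVec2 M2ᵀ, hNN1, hNN2,
      transpose_transpose, transpose_transpose, sub_mulVec, sub_mulVec, dotProduct_sub,
      dotProduct_sub, one_mulVec]
    ring
  rw [← hquad2]
  refine quad_le Q (by simpa [Matrix.IsHermitian] using hQt) _ ?_ f
  clear hquad2 f
  intro l f hf hl
  have hlq : l = f ⬝ᵥ (Q *ᵥ f) := by rw [hl, dotProduct_smul, hf]; simp
  obtain ⟨x, hx⟩ : ∃ x, x = Dᵀ *ᵥ f := ⟨_, rfl⟩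
  have hQL : Q * L = N1ᵀ * (E * b) + N2ᵀ * (Eᵀ * a)
      + (2:ℝ) • (D * (Uᵀ * (E * b)) - D * (Vᵀ * (Eᵀ * a)) - D * (Λ * Dᵀ)) := by
    rw [k1, k2, k3, k4, hQ, Matrix.add_mul, Matrix.add_mul, Matrix.smul_mul,
      ← Matrix.mul_sub, ← Matrix.mul_sub, Matrix.mul_assoc D]
    congr 3
    rw [hD, transpose_sub, Matrix.sub_mul, Matrix.mul_sub]
    abel
  have id1 : l * (f ⬝ᵥ (L *ᵥ f)) = (N1 *ᵥ f + (2:ℝ) • (U *ᵥ x)) ⬝ᵥ (E *ᵥ (b *ᵥ f))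
      + (N2 *ᵥ f - (2:ℝ) • (V *ᵥ x)) ⬝ᵥ (Eᵀ *ᵥ (a *ᵥ f)) - 2 * (x ⬝ᵥ (Λ *ᵥ x)) := by
    have e1 : f ⬝ᵥ ((Q * L) *ᵥ f) = l * (f ⬝ᵥ (L *ᵥ f)) := by
      rw [← mulVec_mulVec, dp_mulVec, hQt, hl, smul_dotProduct, smul_eq_mul]
    rw [← e1, hQL]
    have t1 : (N1 *ᵥ f) ⬝ᵥ (E *ᵥ (b *ᵥ f)) = f ⬝ᵥ ((N1ᵀ * (E * b)) *ᵥ f) := by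
      rw [mulVec_mulVec, dp_mulVec2]
    have t2 : (N2 *ᵥ f) ⬝ᵥ (Eᵀ *ᵥ (a *ᵥ f)) = f ⬝ᵥ ((N2ᵀ * (Eᵀ * a)) *ᵥ f) := by
      rw [mulVec_mulVec, dp_mulVec2]
    have t3 : (U *ᵥ x) ⬝ᵥ (E *ᵥ (b *ᵥ f)) = f ⬝ᵥ ((D * (Uᵀ * (E * b))) *ᵥ f) := by
      rw [hx, mulVec_mulVec, mulVec_mulVec, dp_mulVec2, transpose_mul, transpose_transpose,
        Matrix.mul_assoc]
    have t4 : (V *ᵥ x) ⬝ᵥ (Eᵀ *ᵥ (a *ᵥ f)) = f ⬝ᵥ ((D * (Vᵀ * (Eᵀ * a))) *ᵥ f) := by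
      rw [hx, mulVec_mulVec, mulVec_mulVec, dp_mulVec2, transpose_mul, transpose_transpose,
        Matrix.mul_assoc]
    have t5 : x ⬝ᵥ (Λ *ᵥ x) = f ⬝ᵥ ((D * (Λ * Dᵀ)) *ᵥ f) := by
      rw [hx, mulVec_mulVec, dp_mulVec2, transpose_transpose]
    simp only [add_dotProduct, sub_dotProduct, smul_dotProduct, smul_eq_mul, t1, t2, t3, t4, t5,
      add_mulVec, sub_mulVec, smul_mulVec, dotProduct_add, dotProduct_sub, dotProduct_smul]
    ring
  have g1 : (N1 *ᵥ f + (2:ℝ) • (U *ᵥ x)) ⬝ᵥ (N1 *ᵥ f + (2:ℝ) • (U *ᵥ x)) =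
      (N1 *ᵥ f) ⬝ᵥ (N1 *ᵥ f) + 4 * (x ⬝ᵥ x) := by
    have z1 : (N1 *ᵥ f) ⬝ᵥ (U *ᵥ x) = 0 := by rw [dp_mulVec2, hN1U]; simp
    have z2 : (U *ᵥ x) ⬝ᵥ (U *ᵥ x) = x ⬝ᵥ x := by rw [dp_mulVec2, hU]; simp
    simp only [add_dotProduct, dotProduct_add, smul_dotProduct, dotProduct_smul, smul_eq_mul,
      dotProduct_comm (U *ᵥ x) (N1 *ᵥ f), z1, z2]
    ring
  have g2 : (N2 *ᵥ f - (2:ℝ) • (V *ᵥ x)) ⬝ᵥ (N2 *ᵥ f - (2:ℝ) • (V *ᵥ x)) =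
      (N2 *ᵥ f) ⬝ᵥ (N2 *ᵥ f) + 4 * (x ⬝ᵥ x) := by
    have z1 : (N2 *ᵥ f) ⬝ᵥ (V *ᵥ x) = 0 := by rw [dp_mulVec2, hN2V]; simp
    have z2 : (V *ᵥ x) ⬝ᵥ (V *ᵥ x) = x ⬝ᵥ x := by rw [dp_mulVec2, hV]; simp
    simp only [sub_dotProduct, dotProduct_sub, smul_dotProduct, dotProduct_smul, smul_eq_mul,
      dotProduct_comm (V *ᵥ x) (N2 *ᵥ f), z1, z2]
    ring
  have cs1 := dp_cs (N1 *ᵥ f + (2:ℝ) • (U *ᵥ x)) (E *ᵥ (b *ᵥ f))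
  have cs2 := dp_cs (N2 *ᵥ f - (2:ℝ) • (V *ᵥ x)) (Eᵀ *ᵥ (a *ᵥ f))
  have n1 := hE (b *ᵥ f)
  have n2 := hEt (a *ᵥ f)
  rw [dp_mulVec2 b b, hb, one_mulVec, hf, mul_one] at n1
  rw [dp_mulVec2 a a, ha, one_mulVec, hf, mul_one] at n2
  rw [g1] at cs1
  rw [g2] at cs2
  have hq := hquad f
  rw [← hlq, ← hx] at hq
  have hLf := hL f
  rw [hf, mul_one] at hLf
  have hΛx := hΛ x
  have p1 := dp_nonneg (N1 *ᵥ f)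
  have p2 := dp_nonneg (N2 *ᵥ f)
  have p3 := dp_nonneg x
  exact core_b_scal _ _ _ _ _ _ _ _ _ l δ ε hδ id1 cs1 cs2 n1 n2 hq hLf hΛx p1 p2 p3

lemma core_a {m n K : ℕ} (U a : Matrix (Fin m) (Fin K) ℝ) (b : Matrix (Fin n) (Fin K) ℝ)
    (Λ L M1 M2 : Matrix (Fin K) (Fin K) ℝ) (E : Matrix (Fin m) (Fin n) ℝ) (δ ε : ℝ)
    (hδ : 0 < δ)
    (hU : Uᵀ * U = 1) (ha : aᵀ * a = 1) (hb : bᵀ * b = 1)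
    (hM1 : M1 = aᵀ * U)
    (hE1 : E * b = a * L - U * Λ * M2ᵀ)
    (hLd : ∀ k l, k ≠ l → L k l = 0) (hL : ∀ k, δ / 2 ≤ L k k)
    (hE : ∀ x, (E *ᵥ x) ⬝ᵥ (E *ᵥ x) ≤ ε ^ 2 * (x ⬝ᵥ x)) (f : Fin K → ℝ) :
    (1 - 4 * ε ^ 2 / δ ^ 2) * (f ⬝ᵥ f) ≤ (M1ᵀ *ᵥ f) ⬝ᵥ (M1ᵀ *ᵥ f) ∧
      (M1ᵀ *ᵥ f) ⬝ᵥ (M1ᵀ *ᵥ f) ≤ f ⬝ᵥ f := by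
  have hUa : Uᵀ * a = M1ᵀ := by rw [hM1, transpose_mul, transpose_transpose]
  set N1 := a - U * M1ᵀ with hN1
  have hN1U : N1ᵀ * U = 0 := by
    rw [hN1, transpose_sub, transpose_mul, transpose_transpose, Matrix.sub_mul, Matrix.mul_assoc,
      hU, ← hM1, Matrix.mul_one, sub_self]
  have hN1a : N1ᵀ * a = 1 - M1 * M1ᵀ := by
    rw [hN1, transpose_sub, transpose_mul, transpose_transpose, Matrix.sub_mul, Matrix.mul_assoc,
      hUa, ha]
  have hNN1 : N1ᵀ * N1 = 1 - M1 * M1ᵀ := by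
    conv_lhs => rw [hN1]
    rw [← hN1, Matrix.mul_sub, hN1a, ← Matrix.mul_assoc, hN1U]; simp
  have k1 : N1ᵀ * (E * b) = (1 - M1 * M1ᵀ) * L := by
    rw [hE1, Matrix.mul_sub, ← Matrix.mul_assoc, hN1a, ← Matrix.mul_assoc, ← Matrix.mul_assoc,
      hN1U]; simp
  have hq : (N1 *ᵥ f) ⬝ᵥ (N1 *ᵥ f) = f ⬝ᵥ f - (M1ᵀ *ᵥ f) ⬝ᵥ (M1ᵀ *ᵥ f) := by
    rw [dp_mulVec2, dp_mulVec2, hNN1, transpose_transpose, sub_mulVec, one_mulVec, dotProduct_sub]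
  have hp := dp_nonneg (N1 *ᵥ f)
  refine ⟨?_, by linarith⟩
  have hLpos : ∀ k, 0 < L k k := fun k => lt_of_lt_of_le (by linarith) (hL k)
  let g : Fin K → ℝ := fun i => f i / L i i
  have hLg : L *ᵥ g = f := by
    ext i
    rw [mulVec, dotProduct, Finset.sum_eq_single i]
    · simp only [g]; have := (hLpos i).ne'; field_simp
    · intro j _ hj; rw [hLd i j hj.symm, zero_mul]
    · simp
  have hg : (δ / 2) ^ 2 * (g ⬝ᵥ g) ≤ f ⬝ᵥ f := by
    simp only [dotProduct, Finset.mul_sum]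
    refine Finset.sum_le_sum fun i _ => ?_
    have e : f i = L i i * g i := by simp only [g]; have := (hLpos i).ne'; field_simp
    rw [e]
    have : (δ / 2) ^ 2 ≤ (L i i) ^ 2 := pow_le_pow_left₀ (by linarith) (hL i) 2
    nlinarith [mul_le_mul_of_nonneg_right this (sq_nonneg (g i))]
  have key : (N1 *ᵥ f) ⬝ᵥ (N1 *ᵥ f) = (N1 *ᵥ f) ⬝ᵥ (E *ᵥ (b *ᵥ g)) := by
    rw [mulVec_mulVec, dp_mulVec2, dp_mulVec2, k1, hNN1, ← mulVec_mulVec, hLg]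
  have cs := dp_cs (N1 *ᵥ f) (E *ᵥ (b *ᵥ g))
  rw [← key] at cs
  have n1 := hE (b *ᵥ g)
  rw [dp_mulVec2 b b, hb, one_mulVec] at n1
  have hfin : (N1 *ᵥ f) ⬝ᵥ (N1 *ᵥ f) ≤ ε ^ 2 * (g ⬝ᵥ g) := by
    by_contra hc
    push Not at hc
    have : 0 < (N1 *ᵥ f) ⬝ᵥ (N1 *ᵥ f) :=
      lt_of_le_of_lt (mul_nonneg (sq_nonneg _) (dp_nonneg g)) hc
    nlinarith [mul_le_mul_of_nonneg_left n1 hp]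
  have h2 : g ⬝ᵥ g ≤ 4 / δ ^ 2 * (f ⬝ᵥ f) := by
    rw [div_mul_eq_mul_div, le_div_iff₀ (by positivity)]; linarith
  have h3 := mul_le_mul_of_nonneg_left h2 (sq_nonneg ε)
  have h4 : 4 * ε ^ 2 / δ ^ 2 * (f ⬝ᵥ f) = ε ^ 2 * (4 / δ ^ 2 * (f ⬝ᵥ f)) := by ring
  linarith

lemma core_k1 {m n : ℕ} (A E : Matrix (Fin m) (Fin n) ℝ) (ur hr : Fin m → ℝ) (uc hc : Fin n → ℝ)
    (σ lam δ ε : ℝ) (hδ : 0 < δ) (hσ : 0 ≤ σ) (hlam : δ ≤ lam)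
    (u1 : ur ⬝ᵥ ur = 1) (u2 : uc ⬝ᵥ uc = 1) (v1 : hr ⬝ᵥ hr = 1) (v2 : hc ⬝ᵥ hc = 1)
    (hA1 : A *ᵥ hc = σ • hr) (hA2 : Aᵀ *ᵥ hr = σ • hc)
    (hAE : ∀ x y, x ⬝ᵥ (E *ᵥ y) = x ⬝ᵥ (A *ᵥ y) - lam * (x ⬝ᵥ ur) * (y ⬝ᵥ uc))
    (hA : ur ⬝ᵥ (A *ᵥ uc) ≤ σ)
    (hE : ∀ x, (E *ᵥ x) ⬝ᵥ (E *ᵥ x) ≤ ε ^ 2 * (x ⬝ᵥ x))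
    (s1 : 0 ≤ hr ⬝ᵥ ur) (s2 : hc ⬝ᵥ uc ≤ 0) :
    δ ^ 2 * ((1 + hr ⬝ᵥ ur) * (1 - hc ⬝ᵥ uc)) ≤ 4 * ε ^ 2 := by
  have i0 := hAE (hr + ur) (hc - uc)
  have i1 : (hr + ur) ⬝ᵥ (A *ᵥ (hc - uc)) =
      σ * (1 + hr ⬝ᵥ ur - hc ⬝ᵥ uc) - ur ⬝ᵥ (A *ᵥ uc) := by
    have e1 : hr ⬝ᵥ (A *ᵥ uc) = σ * (hc ⬝ᵥ uc) := by
      rw [dp_mulVec, hA2, smul_dotProduct, smul_eq_mul]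
    simp only [mulVec_sub, hA1, add_dotProduct, dotProduct_sub, dotProduct_smul, e1, v1,
      smul_eq_mul, dotProduct_comm ur hr]
    ring
  have i2 : (hr + ur) ⬝ᵥ ur = 1 + hr ⬝ᵥ ur := by rw [add_dotProduct, u1]; ring
  have i3 : (hc - uc) ⬝ᵥ uc = -(1 - hc ⬝ᵥ uc) := by rw [sub_dotProduct, u2]; ring
  have i4 : (hr + ur) ⬝ᵥ (hr + ur) = 2 * (1 + hr ⬝ᵥ ur) := by
    simp only [add_dotProduct, dotProduct_add, u1, v1, dotProduct_comm ur hr]; ring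
  have i5 : (hc - uc) ⬝ᵥ (hc - uc) = 2 * (1 - hc ⬝ᵥ uc) := by
    simp only [sub_dotProduct, dotProduct_sub, u2, v2, dotProduct_comm uc hc]; ring
  have cs := dp_cs (hr + ur) (E *ᵥ (hc - uc))
  have n1 := hE (hc - uc)
  rw [i1, i2, i3] at i0
  rw [i5] at n1
  rw [i4] at cs
  generalize (hr + ur) ⬝ᵥ (E *ᵥ (hc - uc)) = r at *
  generalize (E *ᵥ (hc - uc)) ⬝ᵥ (E *ᵥ (hc - uc)) = e at *
  generalize ur ⬝ᵥ (A *ᵥ uc) = z at *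
  obtain ⟨p, hp⟩ : ∃ p, p = 1 + hr ⬝ᵥ ur := ⟨_, rfl⟩
  obtain ⟨q, hq⟩ : ∃ q, q = 1 - hc ⬝ᵥ uc := ⟨_, rfl⟩
  rw [← hp] at cs i0 ⊢
  rw [← hq] at n1 i0 ⊢
  have hp1 : 1 ≤ p := by linarith
  have hq1 : 1 ≤ q := by linarith
  have r1 : δ * (p * q) ≤ r := by
    have : 0 ≤ σ * (p - hc ⬝ᵥ uc) - z := by nlinarith
    have h2 : δ * (p * q) ≤ lam * (p * q) := mul_le_mul_of_nonneg_right hlam (by positivity)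
    nlinarith
  have r2 : (δ * (p * q)) ^ 2 ≤ r ^ 2 := pow_le_pow_left₀ (by positivity) r1 2
  have r3 : r ^ 2 ≤ 2 * p * (ε ^ 2 * (2 * q)) := cs.trans (mul_le_mul_of_nonneg_left n1 (by linarith))
  have r4 : (p * q) * (δ ^ 2 * (p * q)) ≤ (p * q) * (4 * ε ^ 2) := by nlinarith
  exact le_of_mul_le_mul_left r4 (by positivity)

end Core2

section Model

lemma min_pos {n K : ℕ} (g : Fin n → Fin K) (hg : Function.Surjective g) (hK : 0 < K) :
    0 < minClusterSize g := by
  have hne : (Set.range (clusterSize g)).Nonempty := ⟨_, ⟨⟨0, hK⟩, rfl⟩⟩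
  obtain ⟨k, hk⟩ := Nat.sInf_mem hne
  unfold minClusterSize
  rw [← hk]
  obtain ⟨i, hi⟩ := hg k
  exact Finset.card_pos.2 ⟨i, by simp [hi]⟩

lemma min_le {n K : ℕ} (g : Fin n → Fin K) (k : Fin K) : minClusterSize g ≤ clusterSize g k :=
  Nat.sInf_le ⟨k, rfl⟩

lemma mem_mulVec {n K : ℕ} (g : Fin n → Fin K) (v : Fin K → ℝ) :
    memMat g *ᵥ v = fun i => v (g i) := by
  ext i
  simp [mulVec, dotProduct, memMat]

lemma mem_gram {n K : ℕ} (g : Fin n → Fin K) :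
    (memMat g)ᵀ * memMat g = diagonal fun k => (clusterSize g k : ℝ) := by
  ext k l
  rw [Matrix.mul_apply, diagonal_apply]
  simp only [transpose_apply, memMat, clusterSize]
  by_cases h : k = l
  · subst h
    simp only [mul_ite, mul_one, mul_zero, ite_self, if_true, Finset.card_filter, Nat.cast_sum, Nat.cast_ite, Nat.cast_one, Nat.cast_zero]
    refine Finset.sum_congr rfl fun i _ => ?_
    by_cases h1 : g i = k <;> simp [h1]
  · rw [if_neg h]
    refine Finset.sum_eq_zero fun i _ => ?_
    by_cases h1 : g i = k
    · have : g i ≠ l := fun h2 => h (h1.symm.trans h2)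
      simp [this]
    · simp [h1]

lemma mem_lower {n K : ℕ} (g : Fin n → Fin K) (v : Fin K → ℝ) :
    (minClusterSize g : ℝ) * (v ⬝ᵥ v) ≤ (memMat g *ᵥ v) ⬝ᵥ (memMat g *ᵥ v) := by
  rw [dp_mulVec2, mem_gram]
  simp only [dotProduct, mulVec_diagonal, Finset.mul_sum]
  refine Finset.sum_le_sum fun i _ => ?_
  have : (minClusterSize g : ℝ) ≤ clusterSize g i := by exact_mod_cast min_le g i
  nlinarith [mul_le_mul_of_nonneg_right this (mul_self_nonneg (v i))]

lemma memT_lower {n K : ℕ} (g : Fin n → Fin K) (v : Fin K → ℝ) :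
    (minClusterSize g : ℝ) * ((memMat g *ᵥ v) ⬝ᵥ (memMat g *ᵥ v)) ≤
      ((memMat g)ᵀ *ᵥ (memMat g *ᵥ v)) ⬝ᵥ ((memMat g)ᵀ *ᵥ (memMat g *ᵥ v)) := by
  rw [dp_mulVec2, mulVec_mulVec, mem_gram]
  simp only [dotProduct, mulVec_diagonal, Finset.mul_sum]
  refine Finset.sum_le_sum fun i _ => ?_
  have : (minClusterSize g : ℝ) ≤ clusterSize g i := by exact_mod_cast min_le g i
  have h2 : 0 ≤ v i * (clusterSize g i * v i) := by
    have := mul_nonneg (Nat.cast_nonneg (α := ℝ) (clusterSize g i)) (mul_self_nonneg (v i))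
    linarith
  nlinarith [mul_le_mul_of_nonneg_right this h2]

lemma eig_nonneg {m n : ℕ} (M : Matrix (Fin m) (Fin n) ℝ) (i : Fin m) :
    0 ≤ (isHermitian_mul_conjTranspose_self M).eigenvalues i :=
  (posSemidef_self_mul_conjTranspose M).eigenvalues_nonneg i

lemma sing_sq {m n : ℕ} (M : Matrix (Fin m) (Fin n) ℝ) (k : ℕ) (hk : 1 ≤ k) (hkm : k ≤ m) :
    kthSingular M k ^ 2 = kthEigMulSelf M k := by
  obtain ⟨i, hi⟩ := kth_mem (isHermitian_mul_conjTranspose_self M).eigenvalues k hk hkm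
  unfold kthSingular
  rw [Real.sq_sqrt]
  unfold kthEigMulSelf
  rw [hi]; exact eig_nonneg M i

lemma sing_quad {m n : ℕ} (M : Matrix (Fin m) (Fin n) ℝ) :
    ∃ V : Matrix (Fin m) (Fin m) ℝ, Vᵀ * V = 1 ∧ V * Vᵀ = 1 ∧ ∀ x, (Mᵀ *ᵥ x) ⬝ᵥ (Mᵀ *ᵥ x) =
      ∑ i, (isHermitian_mul_conjTranspose_self M).eigenvalues i * ((Vᵀ *ᵥ x) i) ^ 2 := by
  obtain ⟨V, h1, h2, h3⟩ := spectral' _ (isHermitian_mul_conjTranspose_self M)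
  refine ⟨V, h1, h2, fun x => ?_⟩
  rw [← quad_diag, ← h3, dp_mulVec2, transpose_transpose]; rfl

lemma sing_lower {m n : ℕ} (M : Matrix (Fin m) (Fin n) ℝ) (hm : 1 ≤ m) (x : Fin m → ℝ) :
    kthSingular M m ^ 2 * (x ⬝ᵥ x) ≤ (Mᵀ *ᵥ x) ⬝ᵥ (Mᵀ *ᵥ x) := by
  obtain ⟨V, h1, h2, h3⟩ := sing_quad M
  rw [h3, ← orth_dp V h2, Finset.mul_sum, sing_sq M m hm le_rfl]
  exact Finset.sum_le_sum fun i _ => mul_le_mul_of_nonneg_right (kth_min _ i) (sq_nonneg _)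

lemma sing_upper {m n : ℕ} (M : Matrix (Fin m) (Fin n) ℝ) (hm : 1 ≤ m) (x : Fin m → ℝ) :
    (Mᵀ *ᵥ x) ⬝ᵥ (Mᵀ *ᵥ x) ≤ kthSingular M 1 ^ 2 * (x ⬝ᵥ x) := by
  obtain ⟨V, h1, h2, h3⟩ := sing_quad M
  rw [h3, ← orth_dp V h2, Finset.mul_sum, sing_sq M 1 le_rfl hm]
  exact Finset.sum_le_sum fun i _ => mul_le_mul_of_nonneg_right (kth_max _ i) (sq_nonneg _)

lemma sing_pos {m n : ℕ} (M : Matrix (Fin m) (Fin n) ℝ) (hm : 1 ≤ m) (hr : M.rank = m) :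
    0 < kthSingular M m := by
  obtain ⟨i, hi⟩ := kth_mem (isHermitian_mul_conjTranspose_self M).eigenvalues m hm le_rfl
  unfold kthSingular kthEigMulSelf
  rw [hi]
  refine Real.sqrt_pos.2 (lt_of_le_of_ne (eig_nonneg M i) ?_)
  have h1 := (isHermitian_mul_conjTranspose_self M).rank_eq_card_non_zero_eigs
  rw [rank_self_mul_conjTranspose, hr] at h1
  have h2 : Fintype.card {i // (isHermitian_mul_conjTranspose_self M).eigenvalues i ≠ 0} =
      Fintype.card (Fin m) := by rw [← h1, Fintype.card_fin]
  intro h0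
  have h3 : Fintype.card {i // (isHermitian_mul_conjTranspose_self M).eigenvalues i ≠ 0} <
      Fintype.card (Fin m) := Fintype.card_subtype_lt (x := i) (fun h => h h0.symm)
  omega

lemma weyl_lower {m n K : ℕ} (A Ω : Matrix (Fin m) (Fin n) ℝ) (U : Matrix (Fin m) (Fin K) ℝ)
    (hU : Uᵀ * U = 1) (δ ε : ℝ) (hε : 0 ≤ ε) (hδε : ε < δ) (hKm : K ≤ m)
    (hΩ : ∀ v, δ ^ 2 * (v ⬝ᵥ v) ≤ (Ωᵀ *ᵥ (U *ᵥ v)) ⬝ᵥ (Ωᵀ *ᵥ (U *ᵥ v)))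
    (hE : ∀ x, ((A - Ω)ᵀ *ᵥ x) ⬝ᵥ ((A - Ω)ᵀ *ᵥ x) ≤ ε ^ 2 * (x ⬝ᵥ x)) (k : Fin K) :
    δ - ε ≤ kthSingular A (k.1 + 1) := by
  by_contra hcon
  push Not at hcon
  have hk1 : k.1 + 1 ≤ m := by have := k.2; omega
  have hs0 : 0 ≤ kthSingular A (k.1 + 1) := Real.sqrt_nonneg _
  have hc : kthEigMulSelf A (k.1 + 1) < (δ - ε) ^ 2 := by
    rw [← sing_sq A _ (by omega) hk1]; exact pow_lt_pow_left₀ hcon hs0 (by norm_num)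
  obtain ⟨V, h1, h2, h3⟩ := sing_quad A
  set d := (isHermitian_mul_conjTranspose_self A).eigenvalues with hd
  have hcount := kth_count d (k.1 + 1) (by omega) hk1 _ hc
  let T : Finset (Fin m) := Finset.univ.filter fun i => ¬ d i < (δ - ε) ^ 2
  have hT : T.card < K := by
    have := Finset.card_filter_add_card_filter_not (s := (Finset.univ : Finset (Fin m)))
      (fun i => d i < (δ - ε) ^ 2)
    rw [Finset.card_univ, Fintype.card_fin] at this
    have hk := k.2
    change (Finset.univ.filter fun i => ¬ d i < (δ - ε) ^ 2).card < K
    omega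
  let φ : (Fin K → ℝ) →ₗ[ℝ] (T → ℝ) :=
    (LinearMap.funLeft ℝ ℝ (fun i : T => i.1)).comp (Matrix.mulVecLin (Vᵀ * U))
  have hker : LinearMap.ker φ ≠ ⊥ := by
    apply LinearMap.ker_ne_bot_of_finrank_lt
    simpa using hT
  obtain ⟨v, hv, hv0⟩ := Submodule.exists_mem_ne_zero_of_ne_bot hker
  have hz : ∀ i, ¬ d i < (δ - ε) ^ 2 → (Vᵀ *ᵥ (U *ᵥ v)) i = 0 := by
    intro i hi
    have := congrFun (LinearMap.mem_ker.1 hv) ⟨i, by simp only [T, Finset.mem_filter]; exact ⟨Finset.mem_univ _, hi⟩⟩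
    rw [mulVec_mulVec]
    exact this
  have hvp := dp_pos v hv0
  have hUv : (U *ᵥ v) ⬝ᵥ (U *ᵥ v) = v ⬝ᵥ v := by rw [dp_mulVec2, hU, one_mulVec]
  have hlt : (Aᵀ *ᵥ (U *ᵥ v)) ⬝ᵥ (Aᵀ *ᵥ (U *ᵥ v)) < (δ - ε) ^ 2 * (v ⬝ᵥ v) := by
    rw [h3, ← hUv, ← orth_dp V h2, Finset.mul_sum]
    have hle : ∀ i, d i * ((Vᵀ *ᵥ (U *ᵥ v)) i) ^ 2 ≤ (δ - ε) ^ 2 * ((Vᵀ *ᵥ (U *ᵥ v)) i) ^ 2 := by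
      intro i
      by_cases hi : d i < (δ - ε) ^ 2
      · exact mul_le_mul_of_nonneg_right hi.le (sq_nonneg _)
      · rw [hz i hi]; simp
    refine Finset.sum_lt_sum (fun i _ => hle i) ?_
    by_contra hno
    push Not at hno
    have hall : ∀ i, ((Vᵀ *ᵥ (U *ᵥ v)) i) ^ 2 = 0 := by
      intro i
      by_cases hi : d i < (δ - ε) ^ 2
      · have := hno i (Finset.mem_univ _)
        nlinarith [sq_nonneg ((Vᵀ *ᵥ (U *ᵥ v)) i)]
      · rw [hz i hi]; simp
    have := orth_dp V h2 (U *ᵥ v)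
    rw [hUv, Finset.sum_eq_zero (fun i _ => hall i)] at this
    linarith
  have q1 := hΩ v
  have q2 := hE (U *ᵥ v)
  rw [hUv] at q2
  obtain ⟨p, hp⟩ : ∃ p, p = Aᵀ *ᵥ (U *ᵥ v) := ⟨_, rfl⟩
  obtain ⟨q, hq⟩ : ∃ q, q = (A - Ω)ᵀ *ᵥ (U *ᵥ v) := ⟨_, rfl⟩
  have hpq : Ωᵀ *ᵥ (U *ᵥ v) = p - q := by
    rw [hp, hq, transpose_sub, sub_mulVec]; abel
  rw [hpq] at q1
  rw [← hp] at hlt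
  rw [← hq] at q2
  have e3 : (p - q) ⬝ᵥ (p - q) = p ⬝ᵥ p + q ⬝ᵥ q - 2 * (p ⬝ᵥ q) := by
    simp only [dotProduct_sub, sub_dotProduct, dotProduct_comm q p]; ring
  rw [e3] at q1
  have cs := dp_cs p q
  have pp := dp_nonneg p
  have qq := dp_nonneg q
  generalize p ⬝ᵥ p = x at *
  generalize q ⬝ᵥ q = y at *
  generalize p ⬝ᵥ q = z at *
  generalize v ⬝ᵥ v = w at *
  have z1 : z ^ 2 ≤ ((δ - ε) * ε * w) ^ 2 := by
    refine cs.trans ((mul_le_mul hlt.le q2 qq (by positivity)).trans (le_of_eq (by ring)))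
  have z2 : -((δ - ε) * ε * w) ≤ z := (abs_le_of_sq_le_sq' z1 (by have : 0 ≤ δ - ε := by linarith
                                                                  positivity)).1
  nlinarith

lemma omega_lower {nr nc Kr Kc : ℕ} (gr : Fin nr → Fin Kr) (gc : Fin nc → Fin Kc)
    (P : Matrix (Fin Kr) (Fin Kc) ℝ) (ρ : ℝ) (hK : 1 ≤ Kr)
    (Ω : Matrix (Fin nr) (Fin nc) ℝ)
    (hΩ : Ω = ρ • (memMat gr * P * (memMat gc)ᵀ)) (y : Fin Kr → ℝ) :
    (kthSingular P Kr * ρ * Real.sqrt ((minClusterSize gr : ℝ) * minClusterSize gc)) ^ 2 *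
      ((memMat gr *ᵥ y) ⬝ᵥ (memMat gr *ᵥ y)) ≤
      (Ωᵀ *ᵥ (memMat gr *ᵥ y)) ⬝ᵥ (Ωᵀ *ᵥ (memMat gr *ᵥ y)) := by
  have e : Ωᵀ *ᵥ (memMat gr *ᵥ y) =
      ρ • (memMat gc *ᵥ (Pᵀ *ᵥ ((memMat gr)ᵀ *ᵥ (memMat gr *ᵥ y)))) := by
    rw [hΩ, transpose_smul, smul_mulVec]
    simp only [transpose_mul, transpose_transpose, mulVec_mulVec, Matrix.mul_assoc]
  rw [e, dotProduct_smul, smul_dotProduct, smul_eq_mul, smul_eq_mul, mul_pow, mul_pow,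
    Real.sq_sqrt (by positivity)]
  have a1 := memT_lower gr y
  set w := (memMat gr)ᵀ *ᵥ (memMat gr *ᵥ y)
  have a2 := sing_lower P hK w
  have a3 := mem_lower gc (Pᵀ *ᵥ w)
  have n1 : (0:ℝ) ≤ minClusterSize gc := by positivity
  have b1 := mul_le_mul_of_nonneg_left a1 (sq_nonneg (kthSingular P Kr))
  have b2 := mul_le_mul_of_nonneg_left (b1.trans a2) n1
  have b3 := mul_le_mul_of_nonneg_left (b2.trans a3) (sq_nonneg ρ)
  refine le_trans (le_of_eq ?_) (b3.trans (le_of_eq ?_)) <;> ring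

lemma lam_ge {nr nc Kr Kc : ℕ} (gr : Fin nr → Fin Kr) (gc : Fin nc → Fin Kc)
    (P : Matrix (Fin Kr) (Fin Kc) ℝ) (ρ : ℝ) 
    (Ω : Matrix (Fin nr) (Fin nc) ℝ)
    (hΩ : Ω = ρ • (memMat gr * P * (memMat gc)ᵀ))
    (Ur : Matrix (Fin nr) (Fin Kr) ℝ) (Uc : Matrix (Fin nc) (Fin Kr) ℝ)
    (Λ : Matrix (Fin Kr) (Fin Kr) ℝ)
    (hUr : Urᵀ * Ur = 1) (hUc : Ucᵀ * Uc = 1)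
    (hΛdiag : ∀ k l, k ≠ l → Λ k l = 0) (hΛpos : ∀ k, 0 < Λ k k)
    (hSVD : Ω = Ur * Λ * Ucᵀ) (k : Fin Kr) :
    kthSingular P Kr * ρ * Real.sqrt ((minClusterSize gr : ℝ) * minClusterSize gc) ≤ Λ k k := by
  have hK : 1 ≤ Kr := by have := k.2; omega
  have hΛT : Λᵀ = Λ := by
    ext i j
    by_cases h : i = j
    · subst h; rfl
    · rw [transpose_apply, hΛdiag i j h, hΛdiag j i (Ne.symm h)]
  have hΛe : Λ *ᵥ (Pi.single k 1) = Λ k k • (Pi.single k 1 : Fin Kr → ℝ) := by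
    ext i
    by_cases h : i = k
    · subst h; simp
    · simp [h, hΛdiag i k h]
  have hs : (Pi.single k 1 : Fin Kr → ℝ) ⬝ᵥ Pi.single k 1 = 1 := by simp
  have h1 : Ω *ᵥ (Uc *ᵥ Pi.single k 1) = Λ k k • (Ur *ᵥ Pi.single k 1) := by
    rw [hSVD, mulVec_mulVec, Matrix.mul_assoc, hUc, Matrix.mul_one, ← mulVec_mulVec, hΛe,
      mulVec_smul]
  have h2 : Ωᵀ *ᵥ (Ur *ᵥ Pi.single k 1) = Λ k k • (Uc *ᵥ Pi.single k 1) := by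
    rw [hSVD, transpose_mul, transpose_mul, transpose_transpose, hΛT, mulVec_mulVec,
      Matrix.mul_assoc, Matrix.mul_assoc, hUr, Matrix.mul_one, ← mulVec_mulVec, hΛe, mulVec_smul]
  have h3 : Ur *ᵥ Pi.single k 1 = memMat gr *ᵥ
      ((Λ k k)⁻¹ • ρ • (P *ᵥ ((memMat gc)ᵀ *ᵥ (Uc *ᵥ Pi.single k 1)))) := by
    have : Ur *ᵥ Pi.single k 1 = (Λ k k)⁻¹ • (Ω *ᵥ (Uc *ᵥ Pi.single k 1)) := by
      rw [h1, smul_smul, inv_mul_cancel₀ (hΛpos k).ne', one_smul]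
    rw [this, hΩ, mulVec_smul, mulVec_smul, smul_mulVec]
    simp only [mulVec_mulVec, Matrix.mul_assoc]
  have h4 := omega_lower gr gc P ρ hK Ω hΩ
    ((Λ k k)⁻¹ • ρ • (P *ᵥ ((memMat gc)ᵀ *ᵥ (Uc *ᵥ Pi.single k 1))))
  rw [← h3, h2, dotProduct_smul, smul_dotProduct, dp_mulVec2, dp_mulVec2, hUr, hUc, one_mulVec, hs,
    smul_eq_mul, smul_eq_mul] at h4
  exact le_of_sq_le_sq (by linarith) (hΛpos k).le

end Model

section Final

lemma case_one {m n : ℕ} (A Ω : Matrix (Fin m) (Fin n) ℝ) (U a : Matrix (Fin m) (Fin 1) ℝ)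
    (V b : Matrix (Fin n) (Fin 1) ℝ) (Λ L : Matrix (Fin 1) (Fin 1) ℝ) (δ ε : ℝ) (hδ : 0 < δ)
    (hεδ : δ ≤ 2 * ε)
    (hU : Uᵀ * U = 1) (hV : Vᵀ * V = 1) (ha : aᵀ * a = 1) (hb : bᵀ * b = 1)
    (hΩ : Ω = U * Λ * Vᵀ) (hΛ : δ ≤ Λ 0 0) (hL0 : 0 ≤ L 0 0) (hA1 : A * b = a * L)
    (hA2 : Aᵀ * a = b * L)
    (hAu : ∀ x, (Aᵀ *ᵥ x) ⬝ᵥ (Aᵀ *ᵥ x) ≤ L 0 0 ^ 2 * (x ⬝ᵥ x))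
    (hE : ∀ x, ((A - Ω) *ᵥ x) ⬝ᵥ ((A - Ω) *ᵥ x) ≤ ε ^ 2 * (x ⬝ᵥ x)) :
    ∃ O : Matrix (Fin 1) (Fin 1) ℝ, Oᵀ * O = 1 ∧ O * Oᵀ = 1 ∧
      1 - 4 * ε ^ 2 / δ ^ 2 ≤ trace (Oᵀ * (aᵀ * U)) ∧
      1 - 4 * ε ^ 2 / δ ^ 2 ≤ trace (Oᵀ * (bᵀ * V)) := by
  have hcol : ∀ {p : ℕ} (X Y : Matrix (Fin p) (Fin 1) ℝ), trace (Xᵀ * Y) = Xᵀ 0 ⬝ᵥ Yᵀ 0 := by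
    intro p X Y
    simp [trace, Matrix.mul_apply, dotProduct]
  have hcol1 : ∀ {p : ℕ} (X : Matrix (Fin p) (Fin 1) ℝ), Xᵀ * X = 1 → Xᵀ 0 ⬝ᵥ Xᵀ 0 = 1 := by
    intro p X h; rw [← hcol, h]; simp
  have ht : 1 - 4 * ε ^ 2 / δ ^ 2 ≤ 0 := by
    rw [sub_nonpos, one_le_div (by positivity)]; nlinarith
  have hml : ∀ {p q : ℕ} (M : Matrix (Fin p) (Fin q) ℝ) (X : Matrix (Fin q) (Fin 1) ℝ)
      (Y : Matrix (Fin p) (Fin 1) ℝ), M * X = Y * L → M *ᵥ (Xᵀ 0) = L 0 0 • Yᵀ 0 := by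
    intro p q M X Y h
    ext i
    have := congrFun (congrFun h i) 0
    simp only [Matrix.mul_apply, Fin.sum_univ_one, Fin.isValue] at this
    simp only [mulVec, dotProduct, transpose_apply, Pi.smul_apply, smul_eq_mul]
    rw [mul_comm, ← this]
  have hΩe : ∀ i j, Ω i j = Λ 0 0 * Uᵀ 0 i * Vᵀ 0 j := by
    intro i j; rw [hΩ]; simp only [Matrix.mul_apply, Fin.sum_univ_one, transpose_apply]; ring
  have hΩv : ∀ y, Ω *ᵥ y = (Λ 0 0 * (y ⬝ᵥ Vᵀ 0)) • Uᵀ 0 := by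
    intro y; ext i
    simp only [mulVec, dotProduct, hΩe, Pi.smul_apply, smul_eq_mul, Finset.mul_sum, Finset.sum_mul]
    exact Finset.sum_congr rfl fun j _ => by ring
  have hAE : ∀ x y, x ⬝ᵥ ((A - Ω) *ᵥ y) =
      x ⬝ᵥ (A *ᵥ y) - Λ 0 0 * (x ⬝ᵥ Uᵀ 0) * (y ⬝ᵥ Vᵀ 0) := by
    intro x y
    rw [sub_mulVec, dotProduct_sub, hΩv, dotProduct_smul, smul_eq_mul]; ring
  have hAE' : ∀ x y, x ⬝ᵥ ((A - Ω)ᵀ *ᵥ y) =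
      x ⬝ᵥ (Aᵀ *ᵥ y) - Λ 0 0 * (x ⬝ᵥ Vᵀ 0) * (y ⬝ᵥ Uᵀ 0) := by
    intro x y
    rw [dp_mulVec, transpose_transpose, dotProduct_comm, hAE, dp_mulVec A, dotProduct_comm x (Aᵀ *ᵥ y)]; ring
  have hA : Uᵀ 0 ⬝ᵥ (A *ᵥ Vᵀ 0) ≤ L 0 0 := by
    rw [dp_mulVec]
    have c := dp_cs (Aᵀ *ᵥ Uᵀ 0) (Vᵀ 0)
    have c2 := hAu (Uᵀ 0)
    rw [hcol1 V hV] at c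
    rw [hcol1 U hU] at c2
    exact (abs_le_of_sq_le_sq' (by linarith) hL0).2
  have hA' : Vᵀ 0 ⬝ᵥ (Aᵀ *ᵥ Uᵀ 0) ≤ L 0 0 := by
    rw [dp_mulVec, transpose_transpose, dotProduct_comm]; exact hA
  have hE' := op_bilin _ _ hE
  have fin1 : ∀ p q : ℝ, 0 ≤ p → q ≤ 0 → δ ^ 2 * ((1 + p) * (1 - q)) ≤ 4 * ε ^ 2 →
      1 - 4 * ε ^ 2 / δ ^ 2 ≤ q := by
    intro p q hp hq h
    have : (1 + p) * (1 - q) ≤ 4 * ε ^ 2 / δ ^ 2 := by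
      rw [le_div_iff₀ (by positivity)]; linarith
    nlinarith [mul_nonneg hp (show 0 ≤ 1 - q by linarith)]
  by_cases s1 : 0 ≤ aᵀ 0 ⬝ᵥ Uᵀ 0
  · refine ⟨1, by simp, by simp, ?_⟩
    simp only [transpose_one, Matrix.one_mul, hcol]
    refine ⟨ht.trans s1, ?_⟩
    by_cases s2 : 0 ≤ bᵀ 0 ⬝ᵥ Vᵀ 0
    · exact ht.trans s2
    · push Not at s2
      exact fin1 _ _ s1 s2.le (core_k1 A (A - Ω) (Uᵀ 0) (aᵀ 0) (Vᵀ 0) (bᵀ 0) (L 0 0) (Λ 0 0) δ ε hδ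
        hL0 hΛ (hcol1 U hU) (hcol1 V hV) (hcol1 a ha) (hcol1 b hb) (hml A b a hA1)
        (hml Aᵀ a b hA2) hAE hA hE s1 s2.le)
  · push Not at s1
    by_cases s2 : 0 ≤ bᵀ 0 ⬝ᵥ Vᵀ 0
    · refine ⟨1, by simp, by simp, ?_⟩
      simp only [transpose_one, Matrix.one_mul, hcol]
      refine ⟨?_, ht.trans s2⟩
      exact fin1 _ _ s2 s1.le (core_k1 Aᵀ (A - Ω)ᵀ (Vᵀ 0) (bᵀ 0) (Uᵀ 0) (aᵀ 0) (L 0 0) (Λ 0 0) δ ε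
        hδ hL0 hΛ (hcol1 V hV) (hcol1 U hU) (hcol1 b hb) (hcol1 a ha) (hml Aᵀ a b hA2)
        (by rw [transpose_transpose]; exact hml A b a hA1) hAE' hA' hE' s2 s1.le)
    · push Not at s2
      refine ⟨-1, by simp, by simp, ?_⟩
      simp only [transpose_neg, transpose_one, Matrix.neg_mul, Matrix.one_mul, trace_neg, hcol]
      constructor <;> linarith

lemma diag_lower {K : ℕ} (L : Matrix (Fin K) (Fin K) ℝ) (hd : ∀ k l, k ≠ l → L k l = 0) (c : ℝ)
    (hL : ∀ k, c ≤ L k k) (x : Fin K → ℝ) : c * (x ⬝ᵥ x) ≤ x ⬝ᵥ (L *ᵥ x) := by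
  have e : L = diagonal fun k => L k k := by
    ext i j
    by_cases h : i = j
    · subst h; simp
    · rw [diagonal_apply_ne _ h, hd i j h]
  rw [e]
  simp only [dotProduct, mulVec_diagonal, Finset.mul_sum]
  refine Finset.sum_le_sum fun i _ => ?_
  nlinarith [mul_le_mul_of_nonneg_right (hL i) (mul_self_nonneg (x i))]

lemma diag_symm {K : ℕ} (L : Matrix (Fin K) (Fin K) ℝ) (hd : ∀ k l, k ≠ l → L k l = 0) :
    Lᵀ = L := by
  ext i j
  by_cases h : i = j
  · subst h; rfl
  · rw [transpose_apply, hd i j h, hd j i (Ne.symm h)]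

/-- trace version of the main bound -/
lemma main_trace {m n K : ℕ} (hK : 1 ≤ K) (hKm : K ≤ m) (A Ω : Matrix (Fin m) (Fin n) ℝ)
    (U a : Matrix (Fin m) (Fin K) ℝ)
    (V b : Matrix (Fin n) (Fin K) ℝ) (Λ L : Matrix (Fin K) (Fin K) ℝ) (δ ε : ℝ) (hδ : 0 < δ)
    (hε : 0 ≤ ε)
    (hU : Uᵀ * U = 1) (hV : Vᵀ * V = 1) (hΛd : ∀ k l, k ≠ l → Λ k l = 0)
    (hΩ : Ω = U * Λ * Vᵀ) (hΛ : ∀ k, δ ≤ Λ k k)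
    (hT : IsTruncSVD A a L b)
    (hE : ∀ x, ((A - Ω) *ᵥ x) ⬝ᵥ ((A - Ω) *ᵥ x) ≤ ε ^ 2 * (x ⬝ᵥ x)) :
    ∃ O : Matrix (Fin K) (Fin K) ℝ, Oᵀ * O = 1 ∧ O * Oᵀ = 1 ∧
      K * (1 - 4 * ε ^ 2 / δ ^ 2) ≤ trace (Oᵀ * (aᵀ * U)) ∧
      K * (1 - 4 * ε ^ 2 / δ ^ 2) ≤ trace (Oᵀ * (bᵀ * V)) := by
  obtain ⟨ha, hb, hLd, hLs, hA1, hA2⟩ := hT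
  have hE' := op_bilin _ _ hE
  by_cases hc : 2 * ε < δ
  · have hΛT := diag_symm Λ hΛd
    have hΩl : ∀ v, δ ^ 2 * (v ⬝ᵥ v) ≤ (Ωᵀ *ᵥ (U *ᵥ v)) ⬝ᵥ (Ωᵀ *ᵥ (U *ᵥ v)) := by
      intro v
      have : Ωᵀ *ᵥ (U *ᵥ v) = V *ᵥ (Λ *ᵥ v) := by
        rw [hΩ, transpose_mul, transpose_mul, transpose_transpose, hΛT, mulVec_mulVec,
          Matrix.mul_assoc, Matrix.mul_assoc, hU, Matrix.mul_one, ← mulVec_mulVec]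
      rw [this, dp_mulVec2, hV, one_mulVec, dp_mulVec2, hΛT]
      refine diag_lower (Λ * Λ) ?_ _ ?_ v
      · intro k l hkl
        rw [Matrix.mul_apply, Finset.sum_eq_single k]
        · rw [hΛd k l hkl, mul_zero]
        · intro j _ hj; rw [hΛd k j hj.symm, zero_mul]
        · simp
      · intro k
        rw [Matrix.mul_apply, Finset.sum_eq_single k]
        · nlinarith [hΛ k]
        · intro j _ hj; rw [hΛd k j hj.symm, zero_mul]
        · simp
    have hLk : ∀ k, δ / 2 ≤ L k k := by
      intro k
      rw [hLs k]
      have := weyl_lower A Ω U hU δ ε hε (by linarith) hKm hΩl hE' k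
      linarith
    have hE1 : (A - Ω) * b = a * L - U * Λ * (bᵀ * V)ᵀ := by
      rw [Matrix.sub_mul, hA1, hΩ, transpose_mul, transpose_transpose, Matrix.mul_assoc (U * Λ)]
    have hE2 : (A - Ω)ᵀ * a = b * L - V * Λ * (aᵀ * U)ᵀ := by
      rw [transpose_sub, Matrix.sub_mul, hA2, hΩ]
      simp only [transpose_mul, transpose_transpose, hΛT, Matrix.mul_assoc]
    have hcore1 := core_a U a b Λ L (aᵀ * U) (bᵀ * V) (A - Ω) δ ε hδ hU ha hb rfl hE1 hLd hLk hE
    have hcore2 := core_a V b a Λ L (bᵀ * V) (aᵀ * U) (A - Ω)ᵀ δ ε hδ hV hb ha rfl hE2 hLd hLk hE'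
    have hcb := core_b U a V b Λ L (aᵀ * U) (bᵀ * V) (A - Ω) δ ε hδ hU hV ha hb rfl rfl hE1 hE2
      (diag_lower Λ hΛd δ hΛ) (diag_lower L hLd _ hLk) hE
    have hγ : 0 < 1 - 4 * ε ^ 2 / δ ^ 2 := by
      rw [sub_pos, div_lt_one (by positivity)]; nlinarith
    refine core_polar (aᵀ * U) (bᵀ * V) _ hγ (fun f => (hcore1 f).1) (fun f => (hcore2 f).1)
      (fun f => (hcore1 f).2) (fun f => (hcore2 f).2) (fun f => (hcb f).trans (le_of_eq ?_))
    ring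
  · push Not at hc
    have ht : 1 - 4 * ε ^ 2 / δ ^ 2 ≤ 0 := by
      rw [sub_nonpos, one_le_div (by positivity)]; nlinarith
    rcases Nat.eq_or_lt_of_le hK with h1 | h2
    · subst h1
      have hL0 : L 0 0 = kthSingular A 1 := hLs 0
      obtain ⟨O, h1, h2, h3, h4⟩ := case_one A Ω U a V b Λ L δ ε hδ hc hU hV ha hb hΩ (hΛ 0)
        (by rw [hL0]; exact Real.sqrt_nonneg _) hA1 hA2
        (fun x => by rw [hL0]; exact sing_upper A hKm x) hE
      refine ⟨O, h1, h2, ?_, ?_⟩ <;> rw [Nat.cast_one, one_mul] <;> assumption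
    · obtain ⟨O, h1, h2, h3, h4⟩ := two_trace h2 (aᵀ * U) (bᵀ * V)
      have : (K : ℝ) * (1 - 4 * ε ^ 2 / δ ^ 2) ≤ 0 := mul_nonpos_of_nonneg_of_nonpos (by positivity) ht
      exact ⟨O, h1, h2, this.trans h3, this.trans h4⟩

end Final


/-- Lemma Appendix A.2 of the paper. Under `BiDFM(Z_r, Z_c, P, ρ)`,
for the compact SVD `Ω = U_r Λ U_cᵀ` and the rank-`K_r` truncated SVD `Û_r Λ̂ Û_cᵀ` of
`A`, there is a `K_r × K_r` orthogonal matrix `Ô` with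
`max(‖Û_r Ô - U_r‖_F, ‖Û_c Ô - U_c‖_F) ≤ 2√(2K_r)‖A-Ω‖/(σ_{K_r}(P) ρ √(n_{r,min} n_{c,min}))`. -/
theorem stmt_4
    {nr nc Kr Kc : ℕ} (hK : Kr ≤ Kc)
    (gr : Fin nr → Fin Kr) (gc : Fin nc → Fin Kc)
    (hgr : Function.Surjective gr) (hgc : Function.Surjective gc)
    (P : Matrix (Fin Kr) (Fin Kc) ℝ) (hPrank : P.rank = Kr)
    (hPle : ∀ k l, |P k l| ≤ 1) (hPmax : ∃ k l, |P k l| = 1)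
    (ρ : ℝ) (hρ : 0 < ρ)
    (Ω : Matrix (Fin nr) (Fin nc) ℝ)
    (hΩ : Ω = ρ • (memMat gr * P * (memMat gc)ᵀ))
    (Ur : Matrix (Fin nr) (Fin Kr) ℝ) (Uc : Matrix (Fin nc) (Fin Kr) ℝ)
    (Λ : Matrix (Fin Kr) (Fin Kr) ℝ)
    (hUr : Urᵀ * Ur = 1) (hUc : Ucᵀ * Uc = 1)
    (hΛdiag : ∀ k l, k ≠ l → Λ k l = 0) (hΛpos : ∀ k, 0 < Λ k k)
    (hSVD : Ω = Ur * Λ * Ucᵀ)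
    (A : Matrix (Fin nr) (Fin nc) ℝ)
    (Uhr : Matrix (Fin nr) (Fin Kr) ℝ) (Lh : Matrix (Fin Kr) (Fin Kr) ℝ)
    (Uhc : Matrix (Fin nc) (Fin Kr) ℝ)
    (hTrunc : IsTruncSVD A Uhr Lh Uhc) :
    ∃ O : Matrix (Fin Kr) (Fin Kr) ℝ, Oᵀ * O = 1 ∧ O * Oᵀ = 1 ∧
      max (frobNorm (Uhr * O - Ur)) (frobNorm (Uhc * O - Uc)) ≤
        2 * Real.sqrt (2 * Kr) * specNorm (A - Ω) /
          (kthSingular P Kr * ρ *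
            Real.sqrt ((minClusterSize gr : ℝ) * minClusterSize gc)) := by
  obtain ⟨k0, l0, -⟩ := hPmax
  have hKr : 1 ≤ Kr := by have := k0.2; omega
  have hKc : 0 < Kc := by have := l0.2; omega
  have hKm : Kr ≤ nr := by simpa using Fintype.card_le_of_surjective gr hgr
  have hδ : 0 < kthSingular P Kr * ρ *
      Real.sqrt ((minClusterSize gr : ℝ) * minClusterSize gc) := by
    have h1 := sing_pos P hKr hPrank
    have h2 : (0 : ℝ) < minClusterSize gr := by exact_mod_cast min_pos gr hgr hKr
    have h3 : (0 : ℝ) < minClusterSize gc := by exact_mod_cast min_pos gc hgc hKc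
    have h4 := Real.sqrt_pos.2 (mul_pos h2 h3)
    positivity
  have hΛ := lam_ge gr gc P ρ Ω hΩ Ur Uc Λ hUr hUc hΛdiag hΛpos hSVD
  generalize kthSingular P Kr * ρ *
      Real.sqrt ((minClusterSize gr : ℝ) * minClusterSize gc) = δ at hδ hΛ ⊢
  have hε := specNorm_nonneg (A - Ω)
  obtain ⟨O, h1, h2, h3, h4⟩ := main_trace hKr hKm A Ω Ur Uhr Uc Uhc Λ Lh δ (specNorm (A - Ω)) hδ hε
    hUr hUc hΛdiag hSVD hΛ hTrunc (specNorm_le (A - Ω))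
  obtain ⟨ha, hb, -⟩ := hTrunc
  refine ⟨O, h1, h2, ?_⟩
  generalize specNorm (A - Ω) = ε at *
  have hB : 0 ≤ 2 * Real.sqrt (2 * Kr) * ε / δ := by positivity
  have hB2 : (2 * Real.sqrt (2 * Kr) * ε / δ) ^ 2 = 8 * Kr * (ε ^ 2 / δ ^ 2) := by
    rw [div_pow, mul_pow, mul_pow, Real.sq_sqrt (by positivity)]; ring
  have hfin : ∀ t : ℝ, Kr * (1 - 4 * ε ^ 2 / δ ^ 2) ≤ t →
      Real.sqrt (2 * Kr - 2 * t) ≤ 2 * Real.sqrt (2 * Kr) * ε / δ := by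
    intro t ht
    rw [Real.sqrt_le_left hB, hB2]
    have e : (Kr : ℝ) * (1 - 4 * ε ^ 2 / δ ^ 2) = Kr - 4 * Kr * (ε ^ 2 / δ ^ 2) := by ring
    linarith
  refine max_le ?_ ?_
  · rw [frob_sq _ _ _ ha hUr h1]; exact hfin _ h3
  · rw [frob_sq _ _ _ hb hUc h1]; exact hfin _ h4
end

section
/- Under BiDCDFM(Z_r, Z_c, P, Θ_r, Θ_c) with K_r ≤ K_c, let Ω = U_r Λ U_c' be the compact singular value decomposition of Ω = Θ_r Z_r P Z_c' Θ_c, and let U_{r,*} and U_{c,*} be the row-normalized versions of U_r and U_c (each nonzero row divided by its Euclidean norm). Then U_{r,*} = Z_r V_r for some V_r ∈ R^{K_r×K_r} with ‖V_r(k,:) − V_r(l,:)‖_F = √2 for all 1 ≤ k < l ≤ K_r, and U_{c,*} = Z_c V_c for some V_c ∈ R^{K_c×K_r}. Consequently U_{r,*}(i_r,:) = U_{r,*}(ī_r,:) whenever row nodes i_r, ī_r lie in the same row cluster, and U_{c,*}(j_c,:) = U_{c,*}(j̄_c,:) whenever column nodes j_c, j̄_c lie in the same column cluster. Furthermore, if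 K_c = K_r then ‖V_c(k,:) − V_c(l,:)‖_F = √2 for all 1 ≤ k < l ≤ K_c. -/
open Matrix Finset MeasureTheory ProbabilityTheory Filter Asymptotics

theorem aux_norm {n K J : ℕ} (g : Fin n → Fin K) (θ : Fin n → ℝ) (hθ : ∀ i, 0 < θ i)
    (X : Matrix (Fin K) (Fin J) ℝ) (U : Matrix (Fin n) (Fin J) ℝ)
    (h : ∀ i j, U i j = θ i * X (g i) j) (i : Fin n) :
    rowNormalize U i = rowNormalize X (g i) := by
  funext j
  have h1 : ∑ l, (U i l) ^ 2 = θ i ^ 2 * ∑ l, (X (g i) l) ^ 2 := by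
    rw [Finset.mul_sum]
    refine Finset.sum_congr rfl fun l _ => ?_
    rw [h]; ring
  unfold rowNormalize
  rw [h1, h, Real.sqrt_mul (sq_nonneg _), Real.sqrt_sq (hθ i).le]
  exact mul_div_mul_left _ _ (hθ i).ne'

theorem aux_mem {n K J : ℕ} (g : Fin n → Fin K) (V : Matrix (Fin K) (Fin J) ℝ)
    (i : Fin n) (j : Fin J) : (memMat g * V) i j = V (g i) j := by
  simp [Matrix.mul_apply, memMat]

theorem aux_dist {n K : ℕ} (g : Fin n → Fin K) (θ : Fin n → ℝ)
    (X : Matrix (Fin K) (Fin K) ℝ) (U : Matrix (Fin n) (Fin K) ℝ)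
    (h : ∀ i j, U i j = θ i * X (g i) j) (hU : Uᵀ * U = 1) (k l : Fin K) (hkl : k ≠ l) :
    rowDist (rowNormalize X) k l = Real.sqrt 2 := by
  set d : Fin K → ℝ := fun k => ∑ i, if g i = k then θ i ^ 2 else 0 with hd
  have h1 : Xᵀ * Matrix.diagonal d * X = 1 := by
    rw [← hU]
    ext a b
    rw [Matrix.mul_apply, Matrix.mul_apply]
    simp only [Matrix.mul_diagonal, Matrix.transpose_apply, h, hd,
      Finset.mul_sum, Finset.sum_mul]
    rw [Finset.sum_comm]
    refine Finset.sum_congr rfl fun i _ => ?_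
    rw [Finset.sum_eq_single (g i)]
    · simp; ring
    · intro c _ hc
      simp [hc.symm]
    · simp
  have h2 : X * (Xᵀ * Matrix.diagonal d) = 1 := mul_eq_one_comm.mp h1
  have h3 : ∀ a b, (∑ j, X a j * X b j) * d b = if a = b then 1 else 0 := by
    intro a b
    have := congrFun (congrFun h2 a) b
    rw [← Matrix.mul_assoc, Matrix.mul_diagonal, Matrix.mul_apply, Matrix.one_apply] at this
    exact this
  have hdne : ∀ a, d a ≠ 0 := by
    intro a ha
    have := h3 a a
    simp [ha] at this
  have h4 : ∀ a, 0 < ∑ j, X a j ^ 2 := by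
    intro a
    refine lt_of_le_of_ne (Finset.sum_nonneg fun _ _ => sq_nonneg _) fun h0 => ?_
    have := h3 a a
    simp only [← pow_two, ← h0] at this
    simp at this
  have h5 : ∑ j, X k j * X l j = 0 := by
    have := h3 k l
    rw [if_neg hkl] at this
    exact (mul_eq_zero.mp this).resolve_right (hdne l)
  have h6 : ∀ a, ∑ j, (rowNormalize X a j) ^ 2 = 1 := by
    intro a
    simp only [rowNormalize, div_pow, Real.sq_sqrt (h4 a).le]
    rw [← Finset.sum_div, div_self (h4 a).ne']
  have h7 : ∑ j, rowNormalize X k j * rowNormalize X l j = 0 := by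
    simp only [rowNormalize, div_mul_div_comm]
    rw [← Finset.sum_div, h5, zero_div]
  unfold rowDist
  congr 1
  have : ∀ j, (rowNormalize X k j - rowNormalize X l j) ^ 2 =
      (rowNormalize X k j) ^ 2 + (rowNormalize X l j) ^ 2
        - 2 * (rowNormalize X k j * rowNormalize X l j) := fun j => by ring
  simp only [this, Finset.sum_sub_distrib, Finset.sum_add_distrib, ← Finset.mul_sum, h6, h7]
  norm_num

/-- Lemma 3.1 of the paper. Under `BiDCDFM(Z_r, Z_c, P, Θ_r, Θ_c)`
with `K_r ≤ K_c`, for the compact SVD `Ω = U_r Λ U_cᵀ` of `Ω = Θ_r Z_r P Z_cᵀ Θ_c`,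
the row-normalized matrices satisfy `U_{r,*} = Z_r V_r` with all pairwise distinct row
distances of `V_r` equal to `√2`, and `U_{c,*} = Z_c V_c`; nodes in the same cluster have
equal rows; and if `K_c = K_r` then the row distances of `V_c` equal `√2` as well. -/
theorem stmt_10
    {nr nc Kr Kc : ℕ} (hK : Kr ≤ Kc)
    (gr : Fin nr → Fin Kr) (gc : Fin nc → Fin Kc)
    (hgr : Function.Surjective gr) (hgc : Function.Surjective gc)
    (P : Matrix (Fin Kr) (Fin Kc) ℝ) (hPrank : P.rank = Kr)
    (hPle : ∀ k l, |P k l| ≤ 1) (hPmax : ∃ k l, |P k l| = 1)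
    (θr : Fin nr → ℝ) (θc : Fin nc → ℝ)
    (hθr : ∀ i, 0 < θr i) (hθc : ∀ j, 0 < θc j)
    (Ω : Matrix (Fin nr) (Fin nc) ℝ)
    (hΩ : Ω = Matrix.diagonal θr * memMat gr * P * (memMat gc)ᵀ * Matrix.diagonal θc)
    (Ur : Matrix (Fin nr) (Fin Kr) ℝ) (Uc : Matrix (Fin nc) (Fin Kr) ℝ)
    (Λ : Matrix (Fin Kr) (Fin Kr) ℝ)
    (hUr : Urᵀ * Ur = 1) (hUc : Ucᵀ * Uc = 1)
    (hΛdiag : ∀ k l, k ≠ l → Λ k l = 0) (hΛpos : ∀ k, 0 < Λ k k)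
    (hSVD : Ω = Ur * Λ * Ucᵀ) :
    (∃ Vr : Matrix (Fin Kr) (Fin Kr) ℝ,
        rowNormalize Ur = memMat gr * Vr ∧
        ∀ k l : Fin Kr, k < l → rowDist Vr k l = Real.sqrt 2) ∧
    (∃ Vc : Matrix (Fin Kc) (Fin Kr) ℝ,
        rowNormalize Uc = memMat gc * Vc ∧
        (Kc = Kr → ∀ k l : Fin Kc, k < l → rowDist Vc k l = Real.sqrt 2)) ∧
    (∀ i i' : Fin nr, gr i = gr i' → rowNormalize Ur i = rowNormalize Ur i') ∧
    (∀ j j' : Fin nc, gc j = gc j' → rowNormalize Uc j = rowNormalize Uc j') := by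
  obtain ⟨M, hM⟩ : ∃ M : Matrix (Fin Kr) (Fin Kr) ℝ, M = Matrix.diagonal fun k => (Λ k k)⁻¹ :=
    ⟨_, rfl⟩
  have hΛ : Λ = Matrix.diagonal fun k => Λ k k := by
    ext a b
    by_cases hab : a = b
    · subst hab; simp
    · simp [hab, hΛdiag a b hab]
  have hΛM : Λ * M = 1 := by
    rw [hM, hΛ, Matrix.diagonal_mul_diagonal, ← Matrix.diagonal_one]
    congr 1
    funext k
    simp [(hΛpos k).ne']
  have hΛt : Λᵀ = Λ := by rw [hΛ, Matrix.diagonal_transpose]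
  have er : Ur = Ω * Uc * M := by
    rw [hSVD, Matrix.mul_assoc (Ur * Λ), hUc, Matrix.mul_one, Matrix.mul_assoc, hΛM,
      Matrix.mul_one]
  have ec : Uc = Ωᵀ * Ur * M := by
    rw [hSVD, Matrix.transpose_mul, Matrix.transpose_mul, Matrix.transpose_transpose, hΛt,
      Matrix.mul_assoc Uc, Matrix.mul_assoc Λ, hUr, Matrix.mul_one, Matrix.mul_assoc, hΛM,
      Matrix.mul_one]
  obtain ⟨X, hX⟩ : ∃ X : Matrix (Fin Kr) (Fin Kr) ℝ, ∀ i j, Ur i j = θr i * X (gr i) j := by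
    refine ⟨P * (memMat gc)ᵀ * Matrix.diagonal θc * Uc * M, fun i j => ?_⟩
    rw [← aux_mem gr (P * (memMat gc)ᵀ * Matrix.diagonal θc * Uc * M), ← Matrix.diagonal_mul]
    conv_lhs => rw [er, hΩ]
    simp only [Matrix.mul_assoc]
  obtain ⟨Y, hY⟩ : ∃ Y : Matrix (Fin Kc) (Fin Kr) ℝ, ∀ i j, Uc i j = θc i * Y (gc i) j := by
    refine ⟨Pᵀ * (memMat gr)ᵀ * Matrix.diagonal θr * Ur * M, fun i j => ?_⟩
    rw [← aux_mem gc (Pᵀ * (memMat gr)ᵀ * Matrix.diagonal θr * Ur * M), ← Matrix.diagonal_mul]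
    conv_lhs => rw [ec, hΩ]
    simp only [Matrix.mul_assoc, Matrix.transpose_mul, Matrix.transpose_transpose,
      Matrix.diagonal_transpose]
  have nr' := aux_norm gr θr hθr X Ur hX
  have nc' := aux_norm gc θc hθc Y Uc hY
  refine ⟨⟨rowNormalize X, ?_, fun k l hkl => aux_dist gr θr X Ur hX hUr k l hkl.ne⟩,
    ⟨rowNormalize Y, ?_, ?_⟩, ?_, ?_⟩
  · ext i j
    rw [aux_mem, nr']
  · ext i j
    rw [aux_mem, nc']
  · intro hKK
    subst hKK
    exact fun k l hkl => aux_dist gc θc Y Uc hY hUc k l hkl.ne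
  · intro i i' h
    rw [nr', nr', h]
  · intro i i' h
    rw [nc', nc', h]
end

section
/- Under BiDCDFM(Z_r, Z_c, P, Θ_r, Θ_c), with Ω = U_r Λ U_c' the compact singular value decomposition of Ω = Θ_r Z_r P Z_c' Θ_c and U_r = Γ_r V_r, U_c = Γ_c V_c as in the SVD factorization via Γ_r, Γ_c, D_r, D_c, every row node i_r with cluster label g_{i_r} satisfies U_r(i_r,:) = (θ_r(i_r)/‖Θ_r Z_r(:,g_{i_r})‖_F) V_r(g_{i_r},:), hence ‖U_r(i_r,:)‖_F = θ_r(i_r)/‖Θ_r Z_r(:,g_{i_r})‖_F ≥ θ_{r,min}/(θ_{r,max} √n_{r,max}); and every column node j_c with cluster label g_{j_c} satisfies U_c(j_c,:) = (θ_c(j_c)/‖Θ_c Z_c(:,g_{j_c})‖_F) V_c(g_{j_c},:), hence ‖U_c(j_c,:)‖_F ≥ (θ_{c,min}/(θ_{c,max} √n_{c,max})) m_{V_c}, where m_{V_c} = min_{1≤k≤K_c} ‖V_c(k,:)‖_F. -/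
open Matrix Finset MeasureTheory ProbabilityTheory Filter Asymptotics

theorem aux_entry {n K : ℕ} (g : Fin n → Fin K) (θ : Fin n → ℝ) (i : Fin n) (k : Fin K) :
    (Matrix.diagonal θ * memMat g) i k = if g i = k then θ i else 0 := by
  rw [Matrix.diagonal_mul]
  simp [memMat]

theorem aux_row {n K J : ℕ} (g : Fin n → Fin K) (θ : Fin n → ℝ)
    (G : Matrix (Fin n) (Fin K) ℝ)
    (hG : ∀ i k, G i k = (Matrix.diagonal θ * memMat g) i k /
      colNormF (Matrix.diagonal θ * memMat g) k)
    (V : Matrix (Fin K) (Fin J) ℝ) (i : Fin n) (k : Fin J) :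
    (G * V) i k = θ i / colNormF (Matrix.diagonal θ * memMat g) (g i) * V (g i) k := by
  rw [Matrix.mul_apply, Finset.sum_eq_single (g i)]
  · rw [hG, aux_entry, if_pos rfl]
  · intro b _ hb
    rw [hG, aux_entry, if_neg (Ne.symm hb)]
    simp
  · simp

theorem aux_norm_s12 {n K J : ℕ} (U : Matrix (Fin n) (Fin J) ℝ) (V : Matrix (Fin K) (Fin J) ℝ)
    (i : Fin n) (l : Fin K) (c : ℝ) (hc : 0 ≤ c) (h : ∀ k, U i k = c * V l k) :
    rowNormF U i = c * rowNormF V l := by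
  unfold rowNormF
  simp_rw [h, mul_pow]
  rw [← Finset.mul_sum, Real.sqrt_mul (sq_nonneg c), Real.sqrt_sq hc]

theorem aux_bound {n K : ℕ} (g : Fin n → Fin K) (θ : Fin n → ℝ) (hθ : ∀ i, 0 < θ i)
    (i : Fin n) :
    (⨅ i, θ i) / ((⨆ i, θ i) * Real.sqrt (maxClusterSize g)) ≤
      θ i / colNormF (Matrix.diagonal θ * memMat g) (g i) := by
  have hle : ∀ j, θ j ≤ ⨆ i, θ i := fun j => le_ciSup (Set.finite_range θ).bddAbove j
  have hmin : (⨅ i, θ i) ≤ θ i := ciInf_le (Set.finite_range θ).bddBelow i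
  have hM : 0 < ⨆ i, θ i := lt_of_lt_of_le (hθ i) (hle i)
  have hs : clusterSize g (g i) ≤ maxClusterSize g :=
    le_csSup (Set.finite_range (clusterSize g)).bddAbove ⟨g i, rfl⟩
  have hpos : 0 < colNormF (Matrix.diagonal θ * memMat g) (g i) := by
    unfold colNormF
    apply Real.sqrt_pos.2
    refine Finset.sum_pos' (fun _ _ => sq_nonneg _) ⟨i, Finset.mem_univ _, ?_⟩
    rw [aux_entry, if_pos rfl]
    exact pow_pos (hθ i) 2
  have hcn : colNormF (Matrix.diagonal θ * memMat g) (g i) ≤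
      (⨆ i, θ i) * Real.sqrt (maxClusterSize g) := by
    unfold colNormF
    rw [← Real.sqrt_sq hM.le, ← Real.sqrt_mul (sq_nonneg _)]
    apply Real.sqrt_le_sqrt
    calc ∑ j, ((Matrix.diagonal θ * memMat g) j (g i)) ^ 2
        ≤ ∑ j, (if g j = g i then (⨆ i, θ i) ^ 2 else 0) := by
          apply Finset.sum_le_sum
          intro j _
          rw [aux_entry]
          split_ifs
          · exact pow_le_pow_left₀ (hθ j).le (hle j) 2
          · simp
      _ = (⨆ i, θ i) ^ 2 * (clusterSize g (g i) : ℝ) := by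
          rw [← Finset.sum_filter, Finset.sum_const, nsmul_eq_mul, mul_comm]
          rfl
      _ ≤ _ := by gcongr
  exact div_le_div₀ (hθ i).le hmin hpos hcn

/-- Under `BiDCDFM(Z_r, Z_c, P, Θ_r, Θ_c)`, with
`U_r = Γ_r V_r` and `U_c = Γ_c V_c` as in the SVD factorization, each row of `U_r`
equals `(θ_r(i)/‖Θ_r Z_r(:,g_i)‖_F) V_r(g_i,:)` and has norm `θ_r(i)/‖Θ_r Z_r(:,g_i)‖_F`
bounded below by `θ_{r,min}/(θ_{r,max} √(n_{r,max}))`, and similarly for the rows of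
`U_c` with the extra factor `m_{V_c}`. -/
theorem stmt_12
    {nr nc Kr Kc : ℕ} (hK : Kr ≤ Kc)
    (gr : Fin nr → Fin Kr) (gc : Fin nc → Fin Kc)
    (hgr : Function.Surjective gr) (hgc : Function.Surjective gc)
    (P : Matrix (Fin Kr) (Fin Kc) ℝ) (hPrank : P.rank = Kr)
    (hPle : ∀ k l, |P k l| ≤ 1) (hPmax : ∃ k l, |P k l| = 1)
    (θr : Fin nr → ℝ) (θc : Fin nc → ℝ)
    (hθr : ∀ i, 0 < θr i) (hθc : ∀ j, 0 < θc j)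
    (Ω : Matrix (Fin nr) (Fin nc) ℝ)
    (hΩ : Ω = Matrix.diagonal θr * memMat gr * P * (memMat gc)ᵀ * Matrix.diagonal θc)
    (Dr : Matrix (Fin Kr) (Fin Kr) ℝ) (Dc : Matrix (Fin Kc) (Fin Kc) ℝ)
    (hDr : Dr = Matrix.diagonal fun k =>
      colNormF (Matrix.diagonal θr * memMat gr) k / vecNormF θr)
    (hDc : Dc = Matrix.diagonal fun l =>
      colNormF (Matrix.diagonal θc * memMat gc) l / vecNormF θc)
    (Γr : Matrix (Fin nr) (Fin Kr) ℝ) (Γc : Matrix (Fin nc) (Fin Kc) ℝ)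
    (hΓr : ∀ i k, Γr i k = (Matrix.diagonal θr * memMat gr) i k /
      colNormF (Matrix.diagonal θr * memMat gr) k)
    (hΓc : ∀ j l, Γc j l = (Matrix.diagonal θc * memMat gc) j l /
      colNormF (Matrix.diagonal θc * memMat gc) l)
    (Vr : Matrix (Fin Kr) (Fin Kr) ℝ) (Sg : Matrix (Fin Kr) (Fin Kr) ℝ)
    (Vc : Matrix (Fin Kc) (Fin Kr) ℝ)
    (hVr : Vrᵀ * Vr = 1) (hVc : Vcᵀ * Vc = 1)
    (hSgdiag : ∀ k l, k ≠ l → Sg k l = 0) (hSgpos : ∀ k, 0 < Sg k k)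
    (hSVDP : Dr * P * Dc = Vr * Sg * Vcᵀ)
    (Ur : Matrix (Fin nr) (Fin Kr) ℝ) (Uc : Matrix (Fin nc) (Fin Kr) ℝ)
    (hUrfac : Ur = Γr * Vr) (hUcfac : Uc = Γc * Vc)
    (θrmin θrmax θcmin θcmax mVc : ℝ)
    (hθrmin : θrmin = ⨅ i, θr i) (hθrmax : θrmax = ⨆ i, θr i)
    (hθcmin : θcmin = ⨅ j, θc j) (hθcmax : θcmax = ⨆ j, θc j)
    (hmVc : mVc = ⨅ k, rowNormF Vc k) :
    (∀ i : Fin nr,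
      (∀ k, Ur i k =
        θr i / colNormF (Matrix.diagonal θr * memMat gr) (gr i) * Vr (gr i) k) ∧
      rowNormF Ur i = θr i / colNormF (Matrix.diagonal θr * memMat gr) (gr i) ∧
      rowNormF Ur i ≥ θrmin / (θrmax * Real.sqrt (maxClusterSize gr))) ∧
    (∀ j : Fin nc,
      (∀ k, Uc j k =
        θc j / colNormF (Matrix.diagonal θc * memMat gc) (gc j) * Vc (gc j) k) ∧
      rowNormF Uc j ≥ θcmin / (θcmax * Real.sqrt (maxClusterSize gc)) * mVc) := by
  subst hUrfac hUcfac hθrmin hθrmax hθcmin hθcmax hmVc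
  have hcr : ∀ i, 0 ≤ θr i / colNormF (Matrix.diagonal θr * memMat gr) (gr i) :=
    fun i => div_nonneg (hθr i).le (Real.sqrt_nonneg _)
  have hcc : ∀ i, 0 ≤ θc i / colNormF (Matrix.diagonal θc * memMat gc) (gc i) :=
    fun i => div_nonneg (hθc i).le (Real.sqrt_nonneg _)
  constructor
  · intro i
    have h1 := aux_row gr θr Γr hΓr Vr i
    have hV : Vr * Vrᵀ = 1 := mul_eq_one_comm.1 hVr
    have hone : rowNormF Vr (gr i) = 1 := by
      have h := congrFun (congrFun hV (gr i)) (gr i)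
      rw [Matrix.mul_apply, Matrix.one_apply_eq] at h
      unfold rowNormF
      simp only [Matrix.transpose_apply, ← pow_two] at h
      rw [h, Real.sqrt_one]
    have h2 := aux_norm_s12 (Γr * Vr) Vr i (gr i) _ (hcr i) h1
    rw [hone, mul_one] at h2
    exact ⟨h1, h2, h2 ▸ aux_bound gr θr hθr i⟩
  · intro j
    have h1 := aux_row gc θc Γc hΓc Vc j
    refine ⟨h1, ?_⟩
    rw [aux_norm_s12 (Γc * Vc) Vc j (gc j) _ (hcc j) h1]
    exact mul_le_mul (aux_bound gc θc hθc j)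
      (ciInf_le (Set.finite_range (rowNormF Vc)).bddBelow (gc j))
      (Real.iInf_nonneg fun _ => Real.sqrt_nonneg _) (hcc j)
end
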